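/- arXiv:2402.15669 — 4 statements merged into one kernel-verified Lean document; each statement's English description precedes it below -/
import Mathlib

section
/- Let n and k be integers with k ≥ 2 and n ≥ k+1, and let T be any tree with n vertices whose diameter is at least k. Then π(T) ≥ [1 + √2 − √2/(2(n−k+1))]·((1+√2)/2)^{k−2} + [1 − √2 + √2/(2(n−k+1))]·((1−√2)/2)^{k−2}, and equality holds if and only if T is isomorphic to the broom graph B(n,k). -/
open scoped Classical

/-- Permanent of the Laplacian matrix of `G` (over `ℝ`). -/
noncomputable def permL {V : Type*} [Fintype V] (G : SimpleGraph V) : ℝ :=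
  (G.lapMatrix ℝ).permanent

/-- Product of the degrees of all vertices of `G`. -/
noncomputable def PD {V : Type*} [Fintype V] (G : SimpleGraph V) : ℝ :=
  ∏ v, (G.degree v : ℝ)

/-- The Laplacian ratio `π(G) = per L(G) / PD(G)`. -/
noncomputable def lapRatio {V : Type*} [Fintype V] (G : SimpleGraph V) : ℝ :=
  permL G / PD G

/-- The broom graph `B(n,k)`: a path on vertices `0, …, k-1` with `n-k` pendant edges
attached at the endvertex `k-1`. -/
def broom (n k : ℕ) : SimpleGraph (Fin n) :=
  SimpleGraph.fromRel fun i j =>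
    ((j : ℕ) = (i : ℕ) + 1 ∧ (j : ℕ) < k) ∨ ((i : ℕ) = k - 1 ∧ k ≤ (j : ℕ))

section Auxiliary

variable {V : Type*}

/-- The degree of `x` in the subgraph of `T` induced by `s`. -/
noncomputable def degIn (T : SimpleGraph V) (s : Finset V) (x : V) : ℕ :=
  (s.filter (T.Adj x)).card

lemma degIn_erase_of_not_adj {T : SimpleGraph V} {s : Finset V} {v x : V} (h : ¬ T.Adj x v) :
    degIn T (s.erase v) x = degIn T s x := by
  unfold degIn
  congr 1
  ext y
  simp only [Finset.mem_filter, Finset.mem_erase]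
  constructor
  · tauto
  · rintro ⟨h1, h2⟩
    exact ⟨⟨fun e => h (e ▸ h2), h1⟩, h2⟩

lemma degIn_erase_of_adj {T : SimpleGraph V} {s : Finset V} {v x : V} (hv : v ∈ s) (h : T.Adj x v) :
    degIn T (s.erase v) x + 1 = degIn T s x := by
  unfold degIn
  rw [Finset.filter_erase, Finset.card_erase_add_one]
  simp [hv, h]

lemma degIn_sdiff_of_not_adj {T : SimpleGraph V} {s L : Finset V} {x : V}
    (h : ∀ y ∈ L, ¬ T.Adj x y) :
    degIn T (s \ L) x = degIn T s x := by
  unfold degIn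
  congr 1
  ext y
  simp only [Finset.mem_filter, Finset.mem_sdiff]
  constructor
  · tauto
  · rintro ⟨h1, h2⟩
    exact ⟨⟨h1, fun e => h y e h2⟩, h2⟩

lemma degIn_eq_one {T : SimpleGraph V} {s : Finset V} {x v : V} (hv : v ∈ s) (h : T.Adj x v)
    (huniq : ∀ y ∈ s, T.Adj x y → y = v) : degIn T s x = 1 := by
  unfold degIn
  rw [Finset.card_eq_one]
  refine ⟨v, ?_⟩
  ext y
  simp only [Finset.mem_filter, Finset.mem_singleton]
  constructor
  · rintro ⟨h1, h2⟩; exact huniq y h1 h2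
  · rintro rfl; exact ⟨hv, h⟩

section Rooted

variable {T : SimpleGraph V} {r : V} {p : V → V} {h : V → ℕ} {s : Finset V}

/-- `T` is a tree with parent map `p` and height function `h`, rooted at the leaf `r`. -/
structure IsRooted (T : SimpleGraph V) (r : V) (p : V → V) (h : V → ℕ) : Prop where
  height_root : h r = 0
  height_parent : ∀ x, x ≠ r → h x = h (p x) + 1
  adj_iff : ∀ x y, T.Adj x y ↔ (x ≠ r ∧ p x = y) ∨ (y ≠ r ∧ p y = x)
  height_one : ∀ x y, h x = 1 → h y = 1 → x = y

/-- `s` contains the root and is closed under taking parents. -/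
structure IsSubtree (r : V) (p : V → V) (s : Finset V) : Prop where
  root_mem : r ∈ s
  parent_mem : ∀ x ∈ s, x ≠ r → p x ∈ s

/-- The vertices of `s` at height `i`. -/
noncomputable def level (h : V → ℕ) (s : Finset V) (i : ℕ) : Finset V :=
  s.filter (fun x => h x = i)

lemma mem_level {i : ℕ} {x : V} : x ∈ level h s i ↔ x ∈ s ∧ h x = i := by simp [level]

/-- All levels up to `k`, except possibly the `j`-th one, are singletons. -/
def BroomLevels (h : V → ℕ) (s : Finset V) (k j : ℕ) : Prop :=
  (∀ i ≤ k, i ≠ j → (level h s i).card = 1) ∧ ∀ x ∈ s, h x ≤ k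

namespace IsRooted

lemma ne_root (hT : IsRooted T r p h) {x : V} (hx : h x ≠ 0) : x ≠ r := by
  rintro rfl; exact hx hT.height_root

lemma height_eq_zero (hT : IsRooted T r p h) {x : V} (hx : h x = 0) : x = r := by
  by_contra hne
  have := hT.height_parent x hne
  omega

lemma adj_parent (hT : IsRooted T r p h) {x : V} (hx : x ≠ r) : T.Adj x (p x) :=
  (hT.adj_iff _ _).2 (Or.inl ⟨hx, rfl⟩)

lemma exists_height (hT : IsRooted T r p h) (hs : IsSubtree r p s) {x : V} (hx : x ∈ s) {i : ℕ}
    (hi : i ≤ h x) : ∃ y ∈ s, h y = i := by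
  induction hn : h x generalizing x with
  | zero => exact ⟨x, hx, by omega⟩
  | succ n ih =>
    by_cases h1 : i = h x
    · exact ⟨x, hx, h1.symm⟩
    · have hxr : x ≠ r := hT.ne_root (by omega)
      have := hT.height_parent x hxr
      exact ih (hs.parent_mem x hx hxr) (by omega) (by omega)

lemma range_subset_image (hT : IsRooted T r p h) (hs : IsSubtree r p s) {k : ℕ}
    (hk : ∃ x ∈ s, k ≤ h x) : Finset.range (k + 1) ⊆ s.image h := by
  obtain ⟨x, hx, hkx⟩ := hk
  intro i hi
  obtain ⟨y, hy, hyi⟩ := hT.exists_height hs hx (i := i) (by simp at hi; omega)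
  exact Finset.mem_image.2 ⟨y, hy, hyi⟩

lemma succ_le_card (hT : IsRooted T r p h) (hs : IsSubtree r p s) {k : ℕ}
    (hk : ∃ x ∈ s, k ≤ h x) : k + 1 ≤ s.card := by
  have := (Finset.card_le_card (hT.range_subset_image hs hk)).trans Finset.card_image_le
  simpa using this

lemma card_level_zero (hT : IsRooted T r p h) (hs : IsSubtree r p s) :
    (level h s 0).card = 1 := by
  rw [Finset.card_eq_one]
  refine ⟨r, ?_⟩
  ext y
  rw [mem_level, Finset.mem_singleton]
  constructor
  · rintro ⟨_, h2⟩; exact hT.height_eq_zero h2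
  · rintro rfl; exact ⟨hs.root_mem, hT.height_root⟩

lemma card_level_one (hT : IsRooted T r p h) (hs : IsSubtree r p s) (hk : ∃ x ∈ s, 1 ≤ h x) :
    (level h s 1).card = 1 := by
  obtain ⟨x, hx, h1⟩ := hk
  obtain ⟨y, hy, hy1⟩ := hT.exists_height hs hx h1
  rw [Finset.card_eq_one]
  refine ⟨y, ?_⟩
  ext z
  rw [mem_level, Finset.mem_singleton]
  constructor
  · rintro ⟨_, h2⟩; exact hT.height_one _ _ h2 hy1
  · rintro rfl; exact ⟨hy, hy1⟩

lemma levels_of_card (hT : IsRooted T r p h) (hs : IsSubtree r p s) {k : ℕ}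
    (hk : ∃ x ∈ s, k ≤ h x) (hc : s.card = k + 1) :
    (∀ i ≤ k, (level h s i).card = 1) ∧ ∀ x ∈ s, h x ≤ k := by
  have hsub := hT.range_subset_image hs hk
  have hle : (s.image h).card ≤ k + 1 := hc ▸ Finset.card_image_le
  have heq : Finset.range (k + 1) = s.image h := Finset.eq_of_subset_of_card_le hsub (by simpa)
  have hinj : Set.InjOn h s := Finset.card_image_iff.1 (by rw [← heq, hc]; simp)
  have hle' : ∀ x ∈ s, h x ≤ k := fun x hx => by
    have : h x ∈ Finset.range (k + 1) := heq ▸ Finset.mem_image_of_mem h hx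
    simp at this; omega
  refine ⟨fun i hi => ?_, hle'⟩
  have : i ∈ s.image h := heq ▸ (by simp; omega)
  obtain ⟨y, hy, rfl⟩ := Finset.mem_image.1 this
  rw [Finset.card_eq_one]
  refine ⟨y, ?_⟩
  ext z
  rw [mem_level, Finset.mem_singleton]
  constructor
  · rintro ⟨h1, h2⟩; exact hinj h1 hy h2
  · rintro rfl; exact ⟨hy, rfl⟩

end IsRooted

lemma exists_unique_of_card_level {i : ℕ} (hc : (level h s i).card = 1) {x y : V} (hx : x ∈ s)
    (hy : y ∈ s) (hxi : h x = i) (hyi : h y = i) : x = y :=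
  Finset.card_le_one.1 hc.le x (mem_level.2 ⟨hx, hxi⟩) y (mem_level.2 ⟨hy, hyi⟩)

lemma exists_max_height {k : ℕ} (hk : ∃ x ∈ s, k ≤ h x) :
    ∃ D, k ≤ D ∧ (∃ x ∈ s, h x = D) ∧ ∀ x ∈ s, h x ≤ D := by
  obtain ⟨x, hx, hkx⟩ := hk
  obtain ⟨y, hy, hmax⟩ := Finset.exists_max_image s h ⟨x, hx⟩
  exact ⟨h y, hkx.trans (hmax x hx), ⟨y, hy, rfl⟩, hmax⟩

lemma level_eq_of_ne {s' : Finset V} {D i : ℕ} (hss : s' ⊆ s) (hD : ∀ x ∈ s, x ∉ s' → h x = D)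
    (hi : i ≠ D) : level h s i = level h s' i := by
  ext x
  simp only [mem_level]
  constructor
  · rintro ⟨h1, h2⟩
    exact ⟨by_contra fun hx => hi (h2 ▸ hD x h1 hx), h2⟩
  · rintro ⟨h1, h2⟩; exact ⟨hss h1, h2⟩

lemma level_eq_sdiff {s' : Finset V} {D : ℕ} (hD : ∀ x ∈ s, x ∉ s' → h x = D)
    (hlt : ∀ x ∈ s', h x < D) : level h s D = s \ s' := by
  ext x
  simp only [mem_level, Finset.mem_sdiff]
  constructor
  · rintro ⟨h1, h2⟩
    exact ⟨h1, fun hx => (hlt x hx).ne h2⟩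
  · rintro ⟨h1, h2⟩; exact ⟨h1, hD x h1 h2⟩

namespace IsRooted

/-- If level `i` is a singleton, then level `i + 1` consists of the children of its element. -/
lemma level_succ_eq_children (hT : IsRooted T r p h) (hs : IsSubtree r p s) {i : ℕ} {w : V}
    (hi : ∀ y ∈ s, h y = i → y = w) (hw : h w = i) :
    level h s (i + 1) = s.filter (fun x => x ≠ r ∧ p x = w) := by
  ext x
  simp only [mem_level, Finset.mem_filter]
  constructor
  · rintro ⟨h1, h2⟩
    have hx : x ≠ r := hT.ne_root (by omega)
    have := hT.height_parent x hx
    exact ⟨h1, hx, hi _ (hs.parent_mem x h1 hx) (by omega)⟩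
  · rintro ⟨h1, h2, h3⟩
    have := hT.height_parent x h2
    exact ⟨h1, by rw [this, h3, hw]⟩

end IsRooted

end Rooted

section Permanent

variable [Fintype V]

/-- The matrix `M` with everything outside the block `s × s` replaced by the identity. -/
noncomputable def matrixRestrict (M : Matrix V V ℝ) (s : Finset V) : Matrix V V ℝ :=
  fun i j => if i ∈ s ∧ j ∈ s then M i j else if i = j then 1 else 0

lemma permanent_restrict_peel (M : Matrix V V ℝ) (s : Finset V) {i v : V} (hi : i ∈ s) (hv : v ∈ s)
    (hiv : i ≠ v) (hrow : ∀ j ∈ s, j ≠ i → j ≠ v → M i j = 0)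
    (hcol : ∀ j ∈ s, j ≠ i → j ≠ v → M j i = 0) :
    (matrixRestrict M s).permanent = M i i * (matrixRestrict M (s.erase i)).permanent +
      M i v * M v i * (matrixRestrict M ((s.erase i).erase v)).permanent := by
  have hshift : (matrixRestrict M ((s.erase i).erase v)).permanent =
      ∑ σ : Equiv.Perm V, ∏ j, matrixRestrict M ((s.erase i).erase v) ((σ * Equiv.swap i v) j) j :=
    (Fintype.sum_equiv (Equiv.mulRight (Equiv.swap i v)) _ _ (fun σ => rfl)).symm
  rw [hshift]
  simp only [Matrix.permanent]
  rw [Finset.mul_sum, Finset.mul_sum, ← Finset.sum_add_distrib]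
  refine Finset.sum_congr rfl fun σ _ => ?_
  have hz : ∀ (N : Matrix V V ℝ) (τ : Equiv.Perm V) (j : V), N (τ j) j = 0 → ∏ j, N (τ j) j = 0 :=
    fun N τ j h => Finset.prod_eq_zero (Finset.mem_univ j) h
  by_cases h1 : σ i = i
  · have h3 : ∏ j, matrixRestrict M ((s.erase i).erase v) ((σ * Equiv.swap i v) j) j = 0 := by
      refine hz _ _ v ?_
      simp [matrixRestrict, h1, hiv]
    rw [h3, mul_zero, add_zero, ← Finset.mul_prod_erase _ _ (Finset.mem_univ i),
      ← Finset.mul_prod_erase Finset.univ (fun j => matrixRestrict M (s.erase i) (σ j) j)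
        (Finset.mem_univ i)]
    have : ∀ j ∈ Finset.univ.erase i, matrixRestrict M s (σ j) j =
        matrixRestrict M (s.erase i) (σ j) j := by
      intro j hj
      have hj : j ≠ i := Finset.ne_of_mem_erase hj
      have : σ j ≠ i := fun h => hj (σ.injective (h.trans h1.symm))
      simp [matrixRestrict, hj, this]
    rw [Finset.prod_congr rfl this]
    simp [matrixRestrict, h1, hi]
  have h2 : ∏ j, matrixRestrict M (s.erase i) (σ j) j = 0 :=
    hz _ _ i (by simp [matrixRestrict, h1])
  rw [h2, mul_zero, zero_add]
  by_cases h4 : σ i = v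
  · by_cases h5 : σ v = i
    · have hvm : v ∈ Finset.univ.erase i := by simp [hiv.symm]
      rw [← Finset.mul_prod_erase _ _ (Finset.mem_univ i),
        ← Finset.mul_prod_erase Finset.univ
          (fun j => matrixRestrict M ((s.erase i).erase v) ((σ * Equiv.swap i v) j) j)
          (Finset.mem_univ i),
        ← Finset.mul_prod_erase _ _ hvm, ← Finset.mul_prod_erase _ (fun j =>
          matrixRestrict M ((s.erase i).erase v) ((σ * Equiv.swap i v) j) j) hvm]
      have : ∀ j ∈ (Finset.univ.erase i).erase v, matrixRestrict M s (σ j) j =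
          matrixRestrict M ((s.erase i).erase v) ((σ * Equiv.swap i v) j) j := by
        intro j hj
        have hjv : j ≠ v := Finset.ne_of_mem_erase hj
        have hji : j ≠ i := Finset.ne_of_mem_erase (Finset.mem_of_mem_erase hj)
        have e1 : σ j ≠ v := fun h => hji (σ.injective (h.trans h4.symm))
        have e2 : σ j ≠ i := fun h => hjv (σ.injective (h.trans h5.symm))
        simp [matrixRestrict, hjv, hji, e1, e2, Equiv.swap_apply_of_ne_of_ne hji hjv]
      rw [Finset.prod_congr rfl this]
      simp [matrixRestrict, h4, h5, hi, hv]
      ring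
    · have : ∏ j, matrixRestrict M ((s.erase i).erase v) ((σ * Equiv.swap i v) j) j = 0 :=
        hz _ _ i (by simp [matrixRestrict, h5])
      rw [this, mul_zero]
      obtain ⟨x, hx⟩ := σ.surjective i
      have hxi : x ≠ i := fun h => h1 (by rw [← h]; rwa [← h] at hx)
      have hxv : x ≠ v := fun h => h5 (by rw [← h]; exact hx)
      refine hz _ _ x ?_
      rw [hx]
      simp only [matrixRestrict, hxi.symm, if_false, hi, true_and]
      split_ifs with h
      · exact hrow x h hxi hxv
      · rfl
  · have : ∏ j, matrixRestrict M ((s.erase i).erase v) ((σ * Equiv.swap i v) j) j = 0 :=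
      hz _ _ v (by simp [matrixRestrict, h4])
    rw [this, mul_zero]
    refine hz _ _ i ?_
    simp only [matrixRestrict, h1, if_false, hi, and_true]
    split_ifs with h
    · exact hcol _ h h1 h4
    · rfl

lemma permanent_restrict_isolated (M : Matrix V V ℝ) (s : Finset V) {i : V} (hi : i ∈ s)
    (hcol : ∀ j ∈ s, j ≠ i → M j i = 0) :
    (matrixRestrict M s).permanent = M i i * (matrixRestrict M (s.erase i)).permanent := by
  simp only [Matrix.permanent]
  rw [Finset.mul_sum]
  refine Finset.sum_congr rfl fun σ _ => ?_
  by_cases h1 : σ i = i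
  · rw [← Finset.mul_prod_erase _ _ (Finset.mem_univ i),
      ← Finset.mul_prod_erase Finset.univ (fun j => matrixRestrict M (s.erase i) (σ j) j)
        (Finset.mem_univ i)]
    have : ∀ j ∈ Finset.univ.erase i, matrixRestrict M s (σ j) j =
        matrixRestrict M (s.erase i) (σ j) j := by
      intro j hj
      have hj : j ≠ i := Finset.ne_of_mem_erase hj
      have : σ j ≠ i := fun h => hj (σ.injective (h.trans h1.symm))
      simp [matrixRestrict, hj, this]
    rw [Finset.prod_congr rfl this]
    simp [matrixRestrict, h1, hi]
  · rw [Finset.prod_eq_zero (Finset.mem_univ i), Finset.prod_eq_zero (Finset.mem_univ i), mul_zero]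
    · simp [matrixRestrict, h1]
    · simp only [matrixRestrict, h1, if_false, hi, and_true]
      split_ifs with h
      · exact hcol _ h h1
      · rfl

lemma permanent_restrict_sub_diag (M N : Matrix V V ℝ) (s : Finset V) {i : V} (hi : i ∈ s)
    (hMN : ∀ j l, (j ≠ i ∨ l ≠ i) → M j l = N j l) :
    (matrixRestrict M s).permanent = (matrixRestrict N s).permanent +
      (M i i - N i i) * (matrixRestrict M (s.erase i)).permanent := by
  simp only [Matrix.permanent]
  rw [Finset.mul_sum, ← Finset.sum_add_distrib]
  refine Finset.sum_congr rfl fun σ _ => ?_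
  by_cases h1 : σ i = i
  · rw [← Finset.mul_prod_erase _ _ (Finset.mem_univ i),
      ← Finset.mul_prod_erase Finset.univ (fun j => matrixRestrict M (s.erase i) (σ j) j)
        (Finset.mem_univ i), ← Finset.mul_prod_erase Finset.univ (fun j => matrixRestrict N s (σ j) j)
        (Finset.mem_univ i)]
    have : ∀ j ∈ Finset.univ.erase i, matrixRestrict M (s.erase i) (σ j) j =
        matrixRestrict M s (σ j) j := by
      intro j hj
      have hj : j ≠ i := Finset.ne_of_mem_erase hj
      have : σ j ≠ i := fun h => hj (σ.injective (h.trans h1.symm))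
      simp [matrixRestrict, hj, this]
    rw [Finset.prod_congr rfl this]
    have : ∀ j ∈ Finset.univ.erase i, matrixRestrict N s (σ j) j =
        matrixRestrict M s (σ j) j := by
      intro j hj
      simp [matrixRestrict, hMN (σ j) j (Or.inr (Finset.ne_of_mem_erase hj))]
    rw [Finset.prod_congr rfl this]
    simp [matrixRestrict, h1, hi]
    ring
  · have : ∏ j, matrixRestrict M (s.erase i) (σ j) j = 0 :=
      Finset.prod_eq_zero (Finset.mem_univ i) (by simp [matrixRestrict, h1])
    rw [this, mul_zero, add_zero]
    refine Finset.prod_congr rfl fun j _ => ?_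
    have : σ j ≠ i ∨ j ≠ i := by
      by_contra! h
      exact h1 (by rw [← h.2]; rw [h.1, h.2])
    simp [matrixRestrict, hMN _ _ this]

/-- The Laplacian matrix of `T` with diagonal replaced by `q`. -/
noncomputable def weightedLap (T : SimpleGraph V) (q : V → ℝ) : Matrix V V ℝ :=
  fun i j => if i = j then q i else if T.Adj i j then -1 else 0

/-- The permanent of the principal submatrix of `weightedLap T q` indexed by `s`. -/
noncomputable def subPerm (T : SimpleGraph V) (q : V → ℝ) (s : Finset V) : ℝ :=
  (matrixRestrict (weightedLap T q) s).permanent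

/-- The Laplacian ratio of the subgraph of `T` induced by `s`. -/
noncomputable def ratioOn (T : SimpleGraph V) (s : Finset V) : ℝ :=
  subPerm T (fun x => degIn T s x) s / ∏ x ∈ s, (degIn T s x : ℝ)

section SubPerm

variable {T : SimpleGraph V}

lemma subPerm_congr {q q' : V → ℝ} {s : Finset V} (h : ∀ x ∈ s, q x = q' x) :
    subPerm T q s = subPerm T q' s := by
  unfold subPerm
  congr 1
  ext i j
  simp only [matrixRestrict, weightedLap]
  split_ifs with h1 h2 <;> simp_all

lemma subPerm_empty (q : V → ℝ) : subPerm T q ∅ = 1 := by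
  have : matrixRestrict (weightedLap T q) ∅ = 1 := by
    ext i j; simp [matrixRestrict, Matrix.one_apply]
  rw [subPerm, this, Matrix.permanent_one]

lemma subPerm_leaf {q : V → ℝ} {s : Finset V} {i v : V} (hi : i ∈ s) (hv : v ∈ s)
    (hadj : T.Adj i v) (huniq : ∀ j ∈ s, T.Adj i j → j = v) :
    subPerm T q s = q i * subPerm T q (s.erase i) + subPerm T q ((s.erase i).erase v) := by
  have h0 : ∀ j ∈ s, j ≠ v → ¬ T.Adj i j := fun j hj hne h => hne (huniq j hj h)
  unfold subPerm
  rw [permanent_restrict_peel (weightedLap T q) s hi hv hadj.ne]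
  · simp [weightedLap, hadj.ne, hadj.ne.symm, hadj, hadj.symm]
  · intro j hj h1 h2
    simp [weightedLap, h1.symm, h0 j hj h2]
  · intro j hj h1 h2
    have : ¬ T.Adj j i := fun h => h0 j hj h2 h.symm
    simp [weightedLap, h1, this]

lemma subPerm_isolated {q : V → ℝ} {s : Finset V} {i : V} (hi : i ∈ s)
    (hiso : ∀ j ∈ s, ¬ T.Adj i j) : subPerm T q s = q i * subPerm T q (s.erase i) := by
  unfold subPerm
  rw [permanent_restrict_isolated (weightedLap T q) s hi]
  · simp [weightedLap]
  · intro j hj h1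
    have : ¬ T.Adj j i := fun h => hiso j hj h.symm
    simp [weightedLap, h1, this]

lemma subPerm_sub_diag {q q' : V → ℝ} {s : Finset V} {i : V} (hi : i ∈ s)
    (h : ∀ j ∈ s, j ≠ i → q j = q' j) :
    subPerm T q s = subPerm T q' s + (q i - q' i) * subPerm T q (s.erase i) := by
  have e : subPerm T q' s = subPerm T (Function.update q i (q' i)) s := by
    refine subPerm_congr fun x hx => ?_
    by_cases hxi : x = i
    · subst hxi; simp
    · simp [hxi, h x hx hxi]
  rw [e]
  unfold subPerm
  rw [permanent_restrict_sub_diag _ (weightedLap T (Function.update q i (q' i))) s hi]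
  · simp [weightedLap]
  · intro j l hjl
    by_cases hj : j = l
    · subst hj
      have : j ≠ i := by tauto
      simp [weightedLap, this]
    · simp [weightedLap, hj]

lemma subPerm_leaves {q : V → ℝ} {s : Finset V} {v : V} (hv : v ∈ s) (L : Finset V) (hL : L ⊆ s)
    (hq : ∀ x ∈ L, q x = 1) (hadj : ∀ x ∈ L, T.Adj x v)
    (huniq : ∀ x ∈ L, ∀ j ∈ s, T.Adj x j → j = v) :
    subPerm T q s = subPerm T q (s \ L) + L.card * subPerm T q ((s \ L).erase v) := by
  induction L using Finset.induction_on with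
  | empty => simp
  | insert x L hx ih =>
    rw [ih (fun y hy => hL (Finset.mem_insert_of_mem hy))
      (fun y hy => hq y (Finset.mem_insert_of_mem hy))
      (fun y hy => hadj y (Finset.mem_insert_of_mem hy))
      (fun y hy => huniq y (Finset.mem_insert_of_mem hy))]
    have hxs : x ∈ s := hL (Finset.mem_insert_self x L)
    have hax := hadj x (Finset.mem_insert_self x L)
    have hux := huniq x (Finset.mem_insert_self x L)
    have hqx := hq x (Finset.mem_insert_self x L)
    have hvL : v ∉ L := fun h => (hadj v (Finset.mem_insert_of_mem h)).ne rfl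
    have e1 : s \ insert x L = (s \ L).erase x := by
      ext y; simp only [Finset.mem_sdiff, Finset.mem_insert, Finset.mem_erase]; tauto
    rw [e1, subPerm_leaf (s := s \ L) (i := x) (v := v) (by simp [hxs, hx]) (by simp [hv, hvL]) hax
      (fun j hj => hux j (Finset.sdiff_subset hj)),
      subPerm_isolated (s := (s \ L).erase v) (i := x) (by simp [hxs, hx, hax.ne])
      (fun j hj h => (Finset.ne_of_mem_erase hj)
        (hux j (Finset.sdiff_subset (Finset.mem_of_mem_erase hj)) h)),
      Finset.card_insert_of_notMem hx, hqx, Finset.erase_right_comm]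
    push_cast
    ring

/-- Removing a pendant star: `v` has exactly one neighbour `w` outside the set `L` of leaves at `v`. -/
lemma pendant_star {s L : Finset V} {v w : V} (hL : L ⊆ s) (hv : v ∈ s) (hw : w ∈ s) (hwL : w ∉ L)
    (hadj : ∀ x ∈ L, T.Adj x v) (huniq : ∀ x ∈ L, ∀ j ∈ s, T.Adj x j → j = v)
    (hvw : T.Adj v w) (hvuniq : ∀ y ∈ s, T.Adj v y → y ∉ L → y = w) :
    ∃ a b Q : ℝ, degIn T ((s \ L).erase v) w + 1 = degIn T s w ∧
      subPerm T (fun x => degIn T s x) s = (2 * L.card + 1) * a + b ∧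
      subPerm T (fun x => degIn T (s \ L) x) (s \ L) = a + b ∧
      subPerm T (fun x => degIn T ((s \ L).erase v) x) ((s \ L).erase v) = a - b ∧
      ∏ x ∈ s, (degIn T s x : ℝ) = (L.card + 1) * degIn T s w * Q ∧
      ∏ x ∈ s \ L, (degIn T (s \ L) x : ℝ) = degIn T s w * Q ∧
      ∏ x ∈ (s \ L).erase v, (degIn T ((s \ L).erase v) x : ℝ) =
        ((degIn T s w : ℝ) - 1) * Q ∧
      a = subPerm T (fun x => degIn T s x) ((s \ L).erase v) ∧
      b = subPerm T (fun x => degIn T s x) (((s \ L).erase v).erase w) ∧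
      Q = ∏ x ∈ ((s \ L).erase v).erase w, (degIn T s x : ℝ) := by
  have hvL : v ∉ L := fun h => (hadj v h).ne rfl
  have hvs : v ∈ s \ L := by simp [hv, hvL]
  have hws : w ∈ s \ L := by simp [hw, hwL]
  have hwR : w ∈ (s \ L).erase v := by simp [hw, hwL, hvw.ne.symm]
  have dL : ∀ x ∈ L, degIn T s x = 1 := fun x hx => degIn_eq_one hv (hadj x hx) (huniq x hx)
  have dv' : degIn T (s \ L) v = 1 := degIn_eq_one hws hvw (fun y hy h => by
    simp only [Finset.mem_sdiff] at hy; exact hvuniq y hy.1 h hy.2)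
  have dv : degIn T s v = L.card + 1 := by
    have : s.filter (T.Adj v) = insert w L := by
      ext y
      simp only [Finset.mem_filter, Finset.mem_insert]
      constructor
      · rintro ⟨h1, h2⟩
        by_cases hy : y ∈ L
        · exact Or.inr hy
        · exact Or.inl (hvuniq y h1 h2 hy)
      · rintro (rfl | hy)
        · exact ⟨hw, hvw⟩
        · exact ⟨hL hy, (hadj y hy).symm⟩
    rw [degIn, this, Finset.card_insert_of_notMem hwL]
  have d' : ∀ x ∈ s \ L, x ≠ v → degIn T (s \ L) x = degIn T s x := by
    intro x hx hxv
    refine degIn_sdiff_of_not_adj fun y hy h => hxv ?_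
    exact huniq y hy x (Finset.sdiff_subset hx) h.symm
  have dw : degIn T ((s \ L).erase v) w + 1 = degIn T s w := by
    rw [degIn_erase_of_adj hvs hvw.symm, d' w hws hvw.ne.symm]
  have d'' : ∀ x ∈ (s \ L).erase v, x ≠ w → degIn T ((s \ L).erase v) x = degIn T s x := by
    intro x hx hxw
    rw [degIn_erase_of_not_adj, d' x (Finset.mem_of_mem_erase hx) (Finset.ne_of_mem_erase hx)]
    have hx := Finset.mem_of_mem_erase hx
    simp only [Finset.mem_sdiff] at hx
    exact fun h => hxw (hvuniq x hx.1 h.symm hx.2)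
  have peel_v : ∀ q : V → ℝ, subPerm T q (s \ L) = q v * subPerm T q ((s \ L).erase v) +
      subPerm T q (((s \ L).erase v).erase w) := fun q =>
    subPerm_leaf hvs hws hvw (fun j hj h => by
      simp only [Finset.mem_sdiff] at hj; exact hvuniq j hj.1 h hj.2)
  have dwR : ((degIn T s w : ℕ) : ℝ) - 1 = (degIn T ((s \ L).erase v) w : ℝ) := by
    rw [← dw]; push_cast; ring
  refine ⟨_, _, _, dw, ?_, ?_, ?_, ?_, ?_, ?_, rfl, rfl, rfl⟩
  · rw [subPerm_leaves hv L hL (fun x hx => by simp [dL x hx]) hadj huniq, peel_v, dv]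
    push_cast
    ring
  · rw [peel_v, dv', subPerm_congr (q := fun x => (degIn T (s \ L) x : ℝ))
      (q' := fun x => (degIn T s x : ℝ)) (s := (s \ L).erase v),
      subPerm_congr (q := fun x => (degIn T (s \ L) x : ℝ))
      (q' := fun x => (degIn T s x : ℝ)) (s := ((s \ L).erase v).erase w)]
    · simp
    · intro x hx
      have hx := Finset.mem_of_mem_erase hx
      simp only [d' x (Finset.mem_of_mem_erase hx) (Finset.ne_of_mem_erase hx)]
    · intro x hx
      simp only [d' x (Finset.mem_of_mem_erase hx) (Finset.ne_of_mem_erase hx)]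
  · rw [subPerm_sub_diag (q := fun x => (degIn T s x : ℝ))
      (q' := fun x => (degIn T ((s \ L).erase v) x : ℝ)) hwR
      (fun j hj hjw => by simp only [d'' j hj hjw])]
    simp only [← dwR]
    ring
  · rw [← Finset.prod_sdiff hL, Finset.prod_congr rfl (fun x hx => by rw [dL x hx]) (s₁ := L),
      ← Finset.mul_prod_erase _ _ hvs, ← Finset.mul_prod_erase _ _ hwR, dv]
    push_cast
    simp
    ring
  · rw [← Finset.mul_prod_erase _ _ hvs, ← Finset.mul_prod_erase _ _ hwR, dv',
      d' w hws hvw.ne.symm]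
    have : ∀ x ∈ ((s \ L).erase v).erase w, (degIn T (s \ L) x : ℝ) = degIn T s x := by
      intro x hx
      have hx := Finset.mem_of_mem_erase hx
      rw [d' x (Finset.mem_of_mem_erase hx) (Finset.ne_of_mem_erase hx)]
    rw [Finset.prod_congr rfl this]
    simp
  · rw [← Finset.mul_prod_erase _ _ hwR, dwR]
    congr 1
    refine Finset.prod_congr rfl fun x hx => ?_
    rw [d'' x (Finset.mem_of_mem_erase hx) (Finset.ne_of_mem_erase hx)]

end SubPerm

end Permanent

section Reduction

variable [Fintype V] {T : SimpleGraph V} {r : V} {p : V → V} {h : V → ℕ} {s : Finset V}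

namespace IsRooted

lemma ratioOn_edge (hT : IsRooted T r p h) (hs : IsSubtree r p s) (hx : ∃ x ∈ s, h x = 1)
    (hmax : ∀ x ∈ s, h x ≤ 1) : ratioOn T s = 2 := by
  obtain ⟨c, hc, hc1⟩ := hx
  have hcr : c ≠ r := hT.ne_root (by omega)
  have hpc : p c = r := hT.height_eq_zero (by have := hT.height_parent c hcr; omega)
  have hadj : T.Adj c r := hpc ▸ hT.adj_parent hcr
  have hcases : ∀ x ∈ s, x = r ∨ x = c := fun x hx => by
    have := hmax x hx
    interval_cases hh : h x
    · exact Or.inl (hT.height_eq_zero hh)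
    · exact Or.inr (hT.height_one _ _ hh hc1)
  have huc : ∀ j ∈ s, T.Adj c j → j = r := fun j hj ha => (hcases j hj).resolve_right ha.ne.symm
  have hur : ∀ j ∈ s, T.Adj r j → j = c := fun j hj ha => (hcases j hj).resolve_left ha.ne.symm
  have dc : degIn T s c = 1 := degIn_eq_one hs.root_mem hadj huc
  have dr : degIn T s r = 1 := degIn_eq_one hc hadj.symm hur
  have hrs : r ∈ s.erase c := by simp [hcr.symm, hs.root_mem]
  have hempty : (s.erase c).erase r = ∅ := by
    ext y
    simp only [Finset.mem_erase, Finset.notMem_empty, iff_false]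
    rintro ⟨h1, h2, h3⟩
    rcases hcases y h3 with h4 | h4 <;> contradiction
  rw [ratioOn, subPerm_leaf hc hs.root_mem hadj huc, subPerm_isolated hrs, hempty, subPerm_empty,
    ← Finset.mul_prod_erase _ _ hc, ← Finset.mul_prod_erase _ _ hrs, hempty, dc, dr]
  · norm_num
  · intro j hj ha
    exact Finset.ne_of_mem_erase hj (hur j (Finset.mem_of_mem_erase hj) ha)

lemma ratioOn_star (hT : IsRooted T r p h) (hs : IsSubtree r p s) (hx : ∃ x ∈ s, h x = 2)
    (hmax : ∀ x ∈ s, h x ≤ 2) : ratioOn T s = 2 := by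
  obtain ⟨c, hc, hc2⟩ := hx
  have hcr : c ≠ r := hT.ne_root (by omega)
  obtain ⟨v, hv⟩ : ∃ v, p c = v := ⟨_, rfl⟩
  have hvs : v ∈ s := hv ▸ hs.parent_mem c hc hcr
  have hv1 : h v = 1 := by have := hT.height_parent c hcr; rw [hv] at this; omega
  have hvr : v ≠ r := hT.ne_root (by omega)
  have hpv : p v = r := hT.height_eq_zero (by have := hT.height_parent v hvr; omega)
  have hadj : T.Adj v r := hpv ▸ hT.adj_parent hvr
  have hpar : ∀ x, h x = 2 → p x = v := fun x hx => by
    have := hT.height_parent x (hT.ne_root (by omega))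
    exact hT.height_one _ _ (by omega) hv1
  have hur : ∀ y ∈ s, T.Adj r y → y = v := by
    intro y _ ha
    rcases (hT.adj_iff _ _).1 ha with ⟨h1, _⟩ | ⟨h1, h2⟩
    · exact absurd rfl h1
    · have := hT.height_parent y h1
      rw [h2, hT.height_root] at this
      exact hT.height_one _ _ this hv1
  have dr : degIn T s r = 1 := degIn_eq_one hvs hadj.symm hur
  obtain ⟨a, b, Q, -, h1, -, -, h2, -, -, ha, hb, hQ⟩ := pendant_star (T := T) (s := s)
    (L := level h s 2) (v := v) (w := r) (Finset.filter_subset _ _) hvs hs.root_mem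
    (by simp [mem_level, hT.height_root])
    (fun x hx => by
      rw [mem_level] at hx
      exact hpar x hx.2 ▸ hT.adj_parent (hT.ne_root (by omega)))
    (fun x hx j hj ha => by
      rw [mem_level] at hx
      rcases (hT.adj_iff _ _).1 ha with ⟨_, h2⟩ | ⟨h1, h2⟩
      · rw [← h2]; exact hpar x hx.2
      · have := hT.height_parent j h1
        have := hmax j hj
        rw [h2] at *; omega)
    hadj
    (fun y hy ha hyL => by
      rcases (hT.adj_iff _ _).1 ha with ⟨_, h2⟩ | ⟨h1, h2⟩
      · rw [← h2]; exact hpv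
      · have := hT.height_parent y h1
        exact absurd (mem_level.2 ⟨hy, by rw [this, h2, hv1]⟩) hyL)
  have hrR : r ∈ (s \ level h s 2).erase v := by
    simp [hvr.symm, hs.root_mem, mem_level, hT.height_root]
  have hempty : ((s \ level h s 2).erase v).erase r = ∅ := by
    ext y
    simp only [Finset.mem_erase, Finset.mem_sdiff, mem_level, Finset.notMem_empty, iff_false]
    rintro ⟨h1, h2, h3, h4⟩
    have := hmax y h3
    interval_cases hh : h y
    · exact h1 (hT.height_eq_zero hh)
    · exact h2 (hT.height_one _ _ hh hv1)
    · exact h4 ⟨h3, rfl⟩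
  rw [hempty] at hb hQ
  rw [subPerm_isolated hrR (fun j hj ha => Finset.ne_of_mem_erase hj
    (hur j (Finset.sdiff_subset (Finset.mem_of_mem_erase hj)) ha)), hempty, dr] at ha
  rw [subPerm_empty] at ha hb
  have : (0 : ℝ) ≤ (level h s 2).card := by positivity
  rw [ratioOn, h1, h2, ha, hb, hQ, dr]
  simp
  field_simp
  ring

/-- Removing the leaf children of a parent `v` of a deepest vertex. -/
lemma exists_reduction (hT : IsRooted T r p h) (hs : IsSubtree r p s) {D : ℕ} (hD : 3 ≤ D)
    (hx : ∃ x ∈ s, h x = D) (hmax : ∀ x ∈ s, h x ≤ D) :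
    ∃ (s' : Finset V) (v : V) (m d : ℕ), s' ⊆ s ∧ v ∈ s' ∧ h v + 1 = D ∧ 1 ≤ m ∧ 2 ≤ d ∧
      s'.card + m = s.card ∧ IsSubtree r p s' ∧ IsSubtree r p (s'.erase v) ∧
      (∀ x ∈ s, x ∉ s' → h x = D) ∧ (∀ x ∈ s', h x = D → p x ≠ v) ∧
      d = (s'.filter (fun x => x ≠ r ∧ p x = p v)).card + 1 ∧
      ratioOn T s = ratioOn T s' + (m / (m + 1) : ℝ) * ((d - 1) / d) * ratioOn T (s'.erase v) := by
  obtain ⟨c, hc, hcD⟩ := hx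
  have hcr : c ≠ r := hT.ne_root (by omega)
  obtain ⟨v, hv⟩ : ∃ v, p c = v := ⟨_, rfl⟩
  have hvs : v ∈ s := hv ▸ hs.parent_mem c hc hcr
  have hvD : h v + 1 = D := by have := hT.height_parent c hcr; rw [hv] at this; omega
  have hvr : v ≠ r := hT.ne_root (by omega)
  obtain ⟨w, hw⟩ : ∃ w, p v = w := ⟨_, rfl⟩
  have hws : w ∈ s := hw ▸ hs.parent_mem v hvs hvr
  have hwD : h w + 2 = D := by have := hT.height_parent v hvr; rw [hw] at this; omega
  have hwr : w ≠ r := hT.ne_root (by omega)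
  have hvw : T.Adj v w := hw ▸ hT.adj_parent hvr
  set L := (level h s D).filter (fun x => p x = v) with hLdef
  have memL : ∀ x, x ∈ L ↔ (x ∈ s ∧ h x = D) ∧ p x = v := by simp [hLdef, mem_level]
  have hLs : L ⊆ s := fun x hx => ((memL x).1 hx).1.1
  have hvL : v ∉ L := fun hh => by have := ((memL v).1 hh).1.2; omega
  have hwL : w ∉ L := fun hh => by have := ((memL w).1 hh).1.2; omega
  have hcL : c ∈ L := (memL c).2 ⟨⟨hc, hcD⟩, hv⟩
  have hchild : ∀ y ∈ s, y ≠ r → p y = v → y ∈ L := fun y hy hyr hyv => by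
    have := hT.height_parent y hyr
    exact (memL y).2 ⟨⟨hy, by rw [this, hyv, hvD]⟩, hyv⟩
  have hsub' : IsSubtree r p (s \ L) := by
    constructor
    · refine Finset.mem_sdiff.2 ⟨hs.root_mem, fun hh => ?_⟩
      have := ((memL r).1 hh).1.2
      rw [hT.height_root] at this; omega
    · intro x hx hxr
      have hxs := (Finset.mem_sdiff.1 hx).1
      refine Finset.mem_sdiff.2 ⟨hs.parent_mem x hxs hxr, fun hh => ?_⟩
      have h1 := ((memL _).1 hh).1.2
      have h2 := hmax x hxs
      have h3 := hT.height_parent x hxr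
      omega
  have hsub'' : IsSubtree r p ((s \ L).erase v) := by
    constructor
    · exact Finset.mem_erase.2 ⟨hvr.symm, hsub'.root_mem⟩
    · intro x hx hxr
      have hx' := Finset.mem_of_mem_erase hx
      refine Finset.mem_erase.2 ⟨fun hh => ?_, hsub'.parent_mem x hx' hxr⟩
      exact (Finset.mem_sdiff.1 hx').2 (hchild x (Finset.mem_sdiff.1 hx').1 hxr hh)
  obtain ⟨a, b, Q, hdw, h1, h2, h3, h4, h5, h6, -⟩ := pendant_star (T := T) hLs hvs hws hwL
    (fun x hx => by
      rw [memL] at hx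
      exact hx.2 ▸ hT.adj_parent (hT.ne_root (by omega)))
    (fun x hx j hj ha => by
      rw [memL] at hx
      rcases (hT.adj_iff _ _).1 ha with ⟨_, h2⟩ | ⟨h1, h2⟩
      · rw [← h2]; exact hx.2
      · have := hT.height_parent j h1
        have := hmax j hj
        rw [h2] at *; omega)
    hvw
    (fun y hy ha hyL => by
      rcases (hT.adj_iff _ _).1 ha with ⟨_, h2⟩ | ⟨h1, h2⟩
      · rw [← h2]; exact hw
      · exact absurd (hchild y hy h1 h2) hyL)
  have hd : degIn T s w = ((s \ L).filter (fun x => x ≠ r ∧ p x = w)).card + 1 := by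
    have : s.filter (T.Adj w) = insert (p w) ((s \ L).filter (fun x => x ≠ r ∧ p x = w)) := by
      ext y
      simp only [Finset.mem_filter, Finset.mem_insert, Finset.mem_sdiff, hT.adj_iff]
      constructor
      · rintro ⟨hy, ⟨_, h2⟩ | ⟨h1, h2⟩⟩
        · exact Or.inl h2.symm
        · refine Or.inr ⟨⟨hy, fun hh => ?_⟩, h1, h2⟩
          have := ((memL y).1 hh).1.2
          have := hT.height_parent y h1
          rw [h2] at this; omega
      · rintro (rfl | ⟨⟨hy, _⟩, h1, h2⟩)
        · exact ⟨hs.parent_mem w hws hwr, Or.inl ⟨hwr, rfl⟩⟩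
        · exact ⟨hy, Or.inr ⟨h1, h2⟩⟩
    rw [degIn, this, Finset.card_insert_of_notMem]
    simp only [Finset.mem_filter, not_and]
    intro _ h1 h2
    have e1 := hT.height_parent w hwr
    have e2 := hT.height_parent _ h1
    rw [h2] at e2; omega
  have hd2 : 2 ≤ degIn T s w := by
    rw [hd]
    have : 0 < ((s \ L).filter (fun x => x ≠ r ∧ p x = w)).card :=
      Finset.card_pos.2 ⟨v, by simp [hvs, hvL, hvr, hw]⟩
    omega
  refine ⟨s \ L, v, L.card, degIn T s w, Finset.sdiff_subset, by simp [hvs, hvL], hvD,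
    Finset.card_pos.2 ⟨c, hcL⟩, hd2, Finset.card_sdiff_add_card_eq_card hLs, hsub', hsub'', ?_, ?_,
    by rw [hw]; exact hd, ?_⟩
  · intro x hx hx'
    have : x ∈ L := by by_contra hh; exact hx' (Finset.mem_sdiff.2 ⟨hx, hh⟩)
    exact ((memL x).1 this).1.2
  · intro x hx hxD hxv
    exact (Finset.mem_sdiff.1 hx).2 ((memL x).2 ⟨⟨(Finset.mem_sdiff.1 hx).1, hxD⟩, hxv⟩)
  · rw [ratioOn, ratioOn, ratioOn, h1, h2, h3, h4, h5, h6]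
    have e1 : (2 : ℝ) ≤ degIn T s w := by exact_mod_cast hd2
    have e2 : (0 : ℝ) ≤ L.card := by positivity
    have e3 : (L.card : ℝ) + 1 ≠ 0 := by positivity
    have e4 : (degIn T s w : ℝ) ≠ 0 := by linarith
    have e5 : (degIn T s w : ℝ) - 1 ≠ 0 := by linarith
    by_cases hQ : Q = 0
    · simp [hQ]
    · field_simp
      ring

end IsRooted

end Reduction

/-- The linear recurrence `u (n + 2) = u (n + 1) + u n / 4` governing the ratios of brooms. -/
noncomputable def broomSeq : ℕ → ℝ
  | 0 => 0
  | 1 => 1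
  | n + 2 => broomSeq (n + 1) + broomSeq n / 4

/-- The ratio of the broom with `n` vertices and diameter `j + 2`. -/
noncomputable def broomRatio (j n : ℕ) : ℝ :=
  broomSeq j * (1 - 1 / ((n : ℝ) - j - 1)) + 2 * broomSeq (j + 1)

lemma broomSeq_nonneg_pos (n : ℕ) : 0 ≤ broomSeq n ∧ 0 < broomSeq (n + 1) := by
  induction n with
  | zero => simp [broomSeq]
  | succ n ih =>
    refine ⟨ih.2.le, ?_⟩
    rw [broomSeq]
    linarith [ih.1, ih.2]

lemma sqrt_two_mul_broomSeq (n : ℕ) : √2 * broomSeq n =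
    ((1 + √2) / 2) ^ n - ((1 - √2) / 2) ^ n := by
  induction n using Nat.twoStepInduction with
  | zero => simp [broomSeq]
  | one => simp [broomSeq]; ring
  | more n ih1 ih2 =>
    have h2 : √2 * √2 = 2 := Real.mul_self_sqrt (by norm_num)
    have ha : ((1 + √2) / 2) ^ 2 = (1 + √2) / 2 + 1 / 4 := by linear_combination h2 / 4
    have hb : ((1 - √2) / 2) ^ 2 = (1 - √2) / 2 + 1 / 4 := by linear_combination h2 / 4
    rw [broomSeq, mul_add, ih2, pow_add _ n 2, pow_add _ n 2, ha, hb]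
    linear_combination ih1 / 4

lemma broomRatio_eq (j n : ℕ) : broomRatio j n =
    (1 + √2 - √2 / (2 * ((n : ℝ) - j - 1))) * ((1 + √2) / 2) ^ j +
      (1 - √2 + √2 / (2 * ((n : ℝ) - j - 1))) * ((1 - √2) / 2) ^ j := by
  have h2 : √2 * √2 = 2 := Real.mul_self_sqrt (by norm_num)
  have hu : ∀ i, broomSeq i = √2 / 2 * (((1 + √2) / 2) ^ i - ((1 - √2) / 2) ^ i) := fun i => by
    linear_combination (√2 / 2) * sqrt_two_mul_broomSeq i - (broomSeq i / 2) * h2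
  have e : √2 / (2 * ((n : ℝ) - j - 1)) = √2 / 2 * (1 / ((n : ℝ) - j - 1)) := by
    rw [div_mul_div_comm, mul_one]
  rw [broomRatio, e, hu, hu, pow_succ, pow_succ]
  linear_combination (((1 + √2) / 2) ^ j + ((1 - √2) / 2) ^ j) / 2 * h2

lemma broom_step {u u' x y m t d : ℝ} (hu : 0 ≤ u) (hu' : 0 < u') (hm : 1 ≤ m) (ht : 0 ≤ t)
    (hd : 2 ≤ d) (hx : u' * (1 - 1 / (2 + t)) + 2 * (u' + u / 4) ≤ x)
    (hy : u * (1 - 1 / (2 + t)) + 2 * u' ≤ y) :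
    (u' + u / 4) * (1 - 1 / (m + 1 + t)) + 2 * (u' + u / 4 + u' / 4) ≤
        x + m / (m + 1) * ((d - 1) / d) * y ∧
      (x + m / (m + 1) * ((d - 1) / d) * y =
        (u' + u / 4) * (1 - 1 / (m + 1 + t)) + 2 * (u' + u / 4 + u' / 4) →
        (m = 1 ∨ t = 0) ∧ d = 2 ∧ x = u' * (1 - 1 / (2 + t)) + 2 * (u' + u / 4)) := by
  have hy0 : 0 < y := by
    have : (0 : ℝ) ≤ 1 - 1 / (2 + t) := by
      rw [sub_nonneg, div_le_one (by linarith)]; linarith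
    have := mul_nonneg hu this
    linarith
  set X := u' * (1 - 1 / (2 + t)) + 2 * (u' + u / 4) with hX
  set Y := u * (1 - 1 / (2 + t)) + 2 * u' with hY
  have key : x + m / (m + 1) * ((d - 1) / d) * y -
      ((u' + u / 4) * (1 - 1 / (m + 1 + t)) + 2 * (u' + u / 4 + u' / 4)) =
      (x - X) + m / (2 * (m + 1)) * (y - Y) + m / (m + 1) * ((d - 2) / (2 * d)) * y +
      (m - 1) * t * (u' * ((m + 3 + t) / (2 * (m + 1) * (2 + t) * (m + 1 + t))) +
        u * ((m + 2 + t) / (4 * (m + 1) * (2 + t) * (m + 1 + t)))) := by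
    rw [hX, hY]
    have h1 : m + 1 ≠ 0 := by positivity
    have h2 : 2 + t ≠ 0 := by positivity
    have h3 : m + 1 + t ≠ 0 := by positivity
    have h4 : d ≠ 0 := by positivity
    field_simp
    ring
  have p1 : 0 ≤ m / (2 * (m + 1)) * (y - Y) := mul_nonneg (by positivity) (by linarith)
  have p2' : 0 < m / (m + 1) := by positivity
  have p2 : 0 ≤ m / (m + 1) * ((d - 2) / (2 * d)) * y :=
    mul_nonneg (mul_nonneg p2'.le (div_nonneg (by linarith) (by linarith))) hy0.le
  have p3' : 0 < u' * ((m + 3 + t) / (2 * (m + 1) * (2 + t) * (m + 1 + t))) +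
        u * ((m + 2 + t) / (4 * (m + 1) * (2 + t) * (m + 1 + t))) := by positivity
  have p3 : 0 ≤ (m - 1) * t * (u' * ((m + 3 + t) / (2 * (m + 1) * (2 + t) * (m + 1 + t))) +
        u * ((m + 2 + t) / (4 * (m + 1) * (2 + t) * (m + 1 + t)))) :=
    mul_nonneg (mul_nonneg (by linarith) ht) p3'.le
  refine ⟨by linarith, fun heq => ⟨?_, ?_, by linarith⟩⟩
  · have : (m - 1) * t * (u' * ((m + 3 + t) / (2 * (m + 1) * (2 + t) * (m + 1 + t))) +
        u * ((m + 2 + t) / (4 * (m + 1) * (2 + t) * (m + 1 + t)))) = 0 := by linarith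
    rcases mul_eq_zero.1 ((mul_eq_zero.1 this).resolve_right p3'.ne') with h | h
    · exact Or.inl (by linarith)
    · exact Or.inr h
  · have : m / (m + 1) * ((d - 2) / (2 * d)) * y = 0 := by linarith
    have := ((mul_eq_zero.1 ((mul_eq_zero.1 this).resolve_right hy0.ne')).resolve_left p2'.ne')
    rcases div_eq_zero_iff.1 this with h | h <;> linarith

lemma double_star_step {x y m q : ℝ} (hm : 1 ≤ m) (hq : 1 ≤ q) (hx : 2 ≤ x) (hy : 2 ≤ y) :
    3 - 1 / (m + q) ≤ x + m / (m + 1) * (q / (q + 1)) * y ∧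
      (x + m / (m + 1) * (q / (q + 1)) * y = 3 - 1 / (m + q) → m = 1 ∨ q = 1) := by
  have key : x + m / (m + 1) * (q / (q + 1)) * y - (3 - 1 / (m + q)) =
      (x - 2) + m / (m + 1) * (q / (q + 1)) * (y - 2) +
        (m - 1) * (q - 1) * ((m + q + 1) / ((m + 1) * (q + 1) * (m + q))) := by
    have h1 : m + 1 ≠ 0 := by positivity
    have h2 : q + 1 ≠ 0 := by positivity
    have h3 : m + q ≠ 0 := by positivity
    field_simp
    ring
  have p1 : 0 ≤ m / (m + 1) * (q / (q + 1)) * (y - 2) := mul_nonneg (by positivity) (by linarith)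
  have p2' : 0 < (m + q + 1) / ((m + 1) * (q + 1) * (m + q)) := by positivity
  have p2 : 0 ≤ (m - 1) * (q - 1) * ((m + q + 1) / ((m + 1) * (q + 1) * (m + q))) :=
    mul_nonneg (mul_nonneg (by linarith) (by linarith)) p2'.le
  refine ⟨by linarith, fun heq => ?_⟩
  have : (m - 1) * (q - 1) * ((m + q + 1) / ((m + 1) * (q + 1) * (m + q))) = 0 := by linarith
  rcases mul_eq_zero.1 ((mul_eq_zero.1 this).resolve_right p2'.ne') with h | h
  · exact Or.inl (by linarith)
  · exact Or.inr (by linarith)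

lemma quarter_le_coeff {m d : ℝ} (hm : 1 ≤ m) (hd : 2 ≤ d) :
    1 / 4 ≤ m / (m + 1) * ((d - 1) / d) := by
  have h1 : 1 / 2 ≤ m / (m + 1) := by rw [div_le_div_iff₀] <;> linarith
  have h2 : 1 / 2 ≤ (d - 1) / d := by rw [div_le_div_iff₀] <;> linarith
  nlinarith

section Bound

variable [Fintype V] {T : SimpleGraph V} {r : V} {p : V → V} {h : V → ℕ} {s : Finset V}

namespace IsRooted

lemma two_le_ratioOn (hT : IsRooted T r p h) (hs : IsSubtree r p s) (hk : ∃ x ∈ s, 1 ≤ h x) :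
    2 ≤ ratioOn T s ∧ ((∃ x ∈ s, 3 ≤ h x) → 2 < ratioOn T s) := by
  induction hN : s.card using Nat.strong_induction_on generalizing s with
  | _ N ih =>
    obtain ⟨D, h1D, hxD, hmax⟩ := exists_max_height hk
    by_cases hD : D < 3
    · have hr : ratioOn T s = 2 := by
        interval_cases D
        · exact hT.ratioOn_edge hs hxD hmax
        · exact hT.ratioOn_star hs hxD hmax
      refine ⟨hr.ge, ?_⟩
      rintro ⟨x, hx, h3⟩
      have := hmax x hx
      omega
    · obtain ⟨s', v, m, d, -, hv, hvD, hm, hd, hcard, hs', hs'', -, -, -, hratio⟩ :=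
        hT.exists_reduction hs (by omega) hxD hmax
      have b1 := (ih s'.card (by omega) hs' ⟨v, hv, by omega⟩ rfl).1
      have hvr : v ≠ r := hT.ne_root (by omega)
      have hpv := hT.height_parent v hvr
      have hpvs : p v ∈ s'.erase v := Finset.mem_erase.2
        ⟨fun e => by rw [e] at hpv; omega, hs'.parent_mem v hv hvr⟩
      have hlt : (s'.erase v).card < s'.card := Finset.card_erase_lt_of_mem hv
      have b2 := (ih (s'.erase v).card (by omega) hs'' ⟨p v, hpvs, by omega⟩ rfl).1
      have hc := quarter_le_coeff (m := m) (d := d) (by exact_mod_cast hm) (by exact_mod_cast hd)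
      have : 2 < ratioOn T s := by rw [hratio]; nlinarith
      exact ⟨this.le, fun _ => this⟩

theorem broomRatio_le_ratioOn (hT : IsRooted T r p h) (hs : IsSubtree r p s) {j : ℕ}
    (hk : ∃ x ∈ s, j + 2 ≤ h x) : broomRatio j s.card ≤ ratioOn T s ∧
      (ratioOn T s = broomRatio j s.card →
        BroomLevels h s (j + 2) (j + 2) ∨ BroomLevels h s (j + 2) 2) := by
  induction hN : s.card using Nat.strong_induction_on generalizing s j with
  | _ N ih =>
    subst hN
    obtain ⟨D, hkD, hxD, hmax⟩ := exists_max_height hk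
    have hk1 : ∃ x ∈ s, 1 ≤ h x := by obtain ⟨x, hx, hxk⟩ := hk; exact ⟨x, hx, by omega⟩
    have l0 := hT.card_level_zero hs
    have l1 := hT.card_level_one hs hk1
    obtain rfl | hj := Nat.eq_zero_or_pos j
    · obtain ⟨b1, b2⟩ := hT.two_le_ratioOn hs hk1
      have e : broomRatio 0 s.card = 2 := by simp [broomRatio, broomSeq]
      rw [e]
      refine ⟨b1, fun heq => Or.inl ⟨fun i hi hi2 => ?_, fun x hx => ?_⟩⟩
      · obtain rfl | rfl : i = 0 ∨ i = 1 := by omega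
        · exact l0
        · exact l1
      · by_contra hx3
        exact (b2 ⟨x, hx, by omega⟩).ne' heq
    obtain ⟨s', v, m, d, hss, hv, hvD, hm, hd, hcard, hs', hs'', hD, -, hdc, hratio⟩ :=
      hT.exists_reduction hs (by omega) hxD hmax
    have hvr : v ≠ r := hT.ne_root (by omega)
    have hpv := hT.height_parent v hvr
    have hpvs' : p v ∈ s' := hs'.parent_mem v hv hvr
    have hpvs : p v ∈ s'.erase v := Finset.mem_erase.2 ⟨fun e => by rw [e] at hpv; omega, hpvs'⟩
    have hlt : (s'.erase v).card + 1 = s'.card := Finset.card_erase_add_one hv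
    have hm' : (1 : ℝ) ≤ m := by exact_mod_cast hm
    have hd' : (2 : ℝ) ≤ d := by exact_mod_cast hd
    have hcs : (s.card : ℝ) = s'.card + m := by rw [← hcard]; push_cast; ring
    have hsdiff : (s \ s').card = m := by
      have := Finset.card_sdiff_add_card_eq_card hss; omega
    obtain ⟨i, rfl⟩ : ∃ i, j = i + 1 := ⟨j - 1, by omega⟩
    obtain rfl | hi := Nat.eq_zero_or_pos i
    · have e : ∀ n, broomRatio (0 + 1) n = 3 - 1 / ((n : ℝ) - 2) := by
        intro n; simp [broomRatio, broomSeq]; ring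
      have b2 := (hT.two_le_ratioOn hs'' ⟨p v, hpvs, by omega⟩).1
      by_cases h3 : ∃ x ∈ s', 3 ≤ h x
      · have b1 := (ih s'.card (by omega) hs' (j := 1) h3 rfl).1
        have hc4 := hT.succ_le_card hs' h3
        have hc4' : (4 : ℝ) ≤ s'.card := by exact_mod_cast hc4
        have hc := quarter_le_coeff hm' hd'
        rw [show (1 : ℕ) = 0 + 1 from rfl, e] at b1
        rw [e]
        have e1 : 1 / ((s'.card : ℝ) - 2) ≤ 1 / 2 := by
          rw [div_le_div_iff₀] <;> linarith
        have e2 : 0 < 1 / ((s.card : ℝ) - 2) := by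
          apply div_pos <;> linarith
        have : 3 - 1 / ((s.card : ℝ) - 2) < ratioOn T s := by rw [hratio]; nlinarith
        exact ⟨this.le, fun heq => absurd heq this.ne'⟩
      · push Not at h3
        have hD3 : D = 3 := by have := h3 v hv; omega
        subst hD3
        have b1 := (hT.two_le_ratioOn hs' ⟨v, hv, by omega⟩).1
        have l0' := hT.card_level_zero hs'
        have l1' := hT.card_level_one hs' ⟨v, hv, by omega⟩
        have l2' : (level h s' 2).card + 1 = d := by
          rw [hdc, ← hT.level_succ_eq_children hs' (i := 1) (w := p v) (fun y hy hy1 =>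
            exists_unique_of_card_level l1' hy hpvs' hy1 (by omega)) (by omega)]
        have hc' : s'.card = d + 1 := by
          rw [Finset.card_eq_sum_card_fiberwise (f := h) (t := Finset.range 3)
            (fun x hx => by have := h3 x hx; simpa using this)]
          simp only [Finset.sum_range_succ, Finset.sum_range_zero]
          simp only [level] at l0' l1' l2'
          omega
        have hq : (1 : ℝ) ≤ (d : ℝ) - 1 := by linarith
        obtain ⟨c1, c2⟩ := double_star_step hm' hq b1 b2
        rw [e, hcs, hc', hratio]
        push_cast
        have e1 : (d : ℝ) + 1 + m - 2 = m + (d - 1) := by ring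
        have e2 : (d : ℝ) - 1 + 1 = d := by ring
        rw [e2] at c1 c2
        rw [e1]
        refine ⟨c1, fun heq => ?_⟩
        have l2 : (level h s 2).card + 1 = d := by
          rw [level_eq_of_ne hss hD (by norm_num), l2']
        have l3 : (level h s 3).card = m := by
          rw [level_eq_sdiff hD h3, hsdiff]
        rcases c2 heq with hm1 | hd1
        · have hm1 : m = 1 := by exact_mod_cast hm1
          refine Or.inr ⟨fun i hi hi2 => ?_, fun x hx => by have := hmax x hx; omega⟩
          obtain rfl | rfl | rfl : i = 0 ∨ i = 1 ∨ i = 3 := by omega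
          · exact l0
          · exact l1
          · omega
        · have hd1 : d = 2 := by
            have : (d : ℝ) = 2 := by linarith
            exact_mod_cast this
          refine Or.inl ⟨fun i hi hi2 => ?_, fun x hx => by have := hmax x hx; omega⟩
          obtain rfl | rfl | rfl : i = 0 ∨ i = 1 ∨ i = 2 := by omega
          · exact l0
          · exact l1
          · omega
    · obtain ⟨l, rfl⟩ : ∃ l, i = l + 1 := ⟨i - 1, by omega⟩
      have hdv : ∃ x ∈ s', l + 1 + 2 ≤ h x := ⟨v, hv, by omega⟩
      obtain ⟨b1, b1e⟩ := ih s'.card (by omega) hs' (j := l + 1) hdv rfl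
      have b2 := (ih (s'.erase v).card (by omega) hs'' (j := l) ⟨p v, hpvs, by omega⟩ rfl).1
      have hcl := hT.succ_le_card hs' hdv
      obtain ⟨t, ht⟩ : ∃ t, s'.card = l + 4 + t := ⟨s'.card - (l + 4), by omega⟩
      have hcs'' : (s'.erase v).card = l + 3 + t := by omega
      obtain ⟨hu, hu'⟩ := broomSeq_nonneg_pos l
      have e1 : broomRatio (l + 1) s'.card = broomSeq (l + 1) * (1 - 1 / (2 + (t : ℝ))) +
          2 * (broomSeq (l + 1) + broomSeq l / 4) := by
        rw [broomRatio, broomSeq, ht]; push_cast; congr 4; ring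
      have e2 : broomRatio l (s'.erase v).card = broomSeq l * (1 - 1 / (2 + (t : ℝ))) +
          2 * broomSeq (l + 1) := by
        rw [broomRatio, hcs'']; push_cast; congr 4; ring
      have e3 : broomRatio (l + 1 + 1) s.card =
          (broomSeq (l + 1) + broomSeq l / 4) * (1 - 1 / ((m : ℝ) + 1 + t)) +
          2 * (broomSeq (l + 1) + broomSeq l / 4 + broomSeq (l + 1) / 4) := by
        rw [broomRatio, broomSeq, broomSeq, hcs, ht]; push_cast; congr 4; ring
      rw [e1] at b1
      rw [e2] at b2
      obtain ⟨c1, c2⟩ := broom_step hu hu' hm' (Nat.cast_nonneg t) hd' b1 b2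
      rw [e3, hratio]
      refine ⟨c1, fun heq => ?_⟩
      obtain ⟨hmt, hd2, hxe⟩ := c2 heq
      have hd2 : d = 2 := by exact_mod_cast hd2
      by_cases ht0 : t = 0
      · obtain ⟨f1, f2⟩ := hT.levels_of_card hs' (k := l + 3) hdv (by omega)
        have hDl : D = l + 4 := by have := f2 v hv; omega
        refine Or.inl ⟨fun i hi hi2 => ?_, fun x hx => by have := hmax x hx; omega⟩
        rw [level_eq_of_ne hss hD (by omega)]
        exact f1 i (by omega)
      have hm1 : m = 1 := by
        rcases hmt with hh | hh
        · exact_mod_cast hh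
        · exact absurd (by exact_mod_cast hh) ht0
      rcases b1e (by rw [e1]; exact hxe) with ⟨f1, f2⟩ | ⟨f1, f2⟩
      · have hDl : D = l + 4 := by have := f2 v hv; omega
        refine Or.inl ⟨fun i hi hi2 => ?_, fun x hx => by have := hmax x hx; omega⟩
        rw [level_eq_of_ne hss hD (by omega)]
        by_cases hil : i = l + 3
        · subst hil
          rw [hT.level_succ_eq_children hs' (i := l + 2) (w := p v) (fun y hy hy1 =>
            exists_unique_of_card_level (f1 (l + 2) (by omega) (by omega)) hy hpvs' hy1 (by omega))
            (by omega)]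
          omega
        · exact f1 i (by omega) (by omega)
      · have hDl : D = l + 4 := by have := f2 v hv; omega
        refine Or.inr ⟨fun i hi hi2 => ?_, fun x hx => by have := hmax x hx; omega⟩
        by_cases hil : i = l + 4
        · rw [hil, ← hDl, level_eq_sdiff hD (fun x hx => by have := f2 x hx; omega), hsdiff, hm1]
        · rw [level_eq_of_ne hss hD (by omega)]
          exact f1 i (by omega) hi2

theorem ratioOn_of_broomLevels (hT : IsRooted T r p h) (hs : IsSubtree r p s) {j : ℕ}
    (hk : ∃ x ∈ s, h x = j + 2) (hb : BroomLevels h s (j + 2) (j + 2)) :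
    ratioOn T s = broomRatio j s.card := by
  induction j using Nat.strong_induction_on generalizing s with
  | _ j ih =>
    obtain rfl | hj := Nat.eq_zero_or_pos j
    · rw [hT.ratioOn_star hs hk hb.2]; simp [broomRatio, broomSeq]
    obtain ⟨s', v, m, d, hss, hv, hvD, hm, hd, hcard, hs', hs'', hD, hD', hdc, hratio⟩ :=
      hT.exists_reduction hs (by omega) hk hb.2
    obtain ⟨i, rfl⟩ : ∃ i, j = i + 1 := ⟨j - 1, by omega⟩
    have hvr : v ≠ r := hT.ne_root (by omega)
    have hpv := hT.height_parent v hvr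
    have hpvs' : p v ∈ s' := hs'.parent_mem v hv hvr
    have hpvs : p v ∈ s'.erase v := Finset.mem_erase.2 ⟨fun e => by rw [e] at hpv; omega, hpvs'⟩
    have hlt : (s'.erase v).card + 1 = s'.card := Finset.card_erase_add_one hv
    have hlev : ∀ a ≤ i + 2, (level h s' a).card = 1 := fun a ha => by
      rw [← level_eq_of_ne hss hD (by omega)]
      exact hb.1 a (by omega) (by omega)
    have hmax' : ∀ x ∈ s', h x ≤ i + 2 := fun x hx => by
      have h1 := hb.2 x (hss hx)
      by_contra h2
      have hx3 : h x = i + 1 + 2 := by omega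
      have hxr : x ≠ r := hT.ne_root (by omega)
      have := hT.height_parent x hxr
      exact hD' x hx hx3 (exists_unique_of_card_level (hlev (i + 2) le_rfl)
        (hs'.parent_mem x hx hxr) hv (by omega) (by omega))
    have hb' : BroomLevels h s' (i + 2) (i + 2) := ⟨fun a ha _ => hlev a ha, hmax'⟩
    have hmax'' : ∀ x ∈ s'.erase v, h x ≤ i + 1 := fun x hx => by
      have h1 := hmax' x (Finset.mem_of_mem_erase hx)
      by_contra h2
      exact Finset.ne_of_mem_erase hx (exists_unique_of_card_level (hlev (i + 2) le_rfl)
        (Finset.mem_of_mem_erase hx) hv (by omega) (by omega))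
    have hlev'' : ∀ a ≤ i + 1, (level h (s'.erase v) a).card = 1 := fun a ha => by
      rw [← level_eq_of_ne (s := s') (D := i + 2) (Finset.erase_subset _ _)
        (fun x hx hxv => ?_) (by omega)]
      · exact hlev a (by omega)
      · have : x = v := by by_contra hne; exact hxv (Finset.mem_erase.2 ⟨hne, hx⟩)
        rw [this]; omega
    have hd2 : d = 2 := by
      rw [hdc, ← hT.level_succ_eq_children hs' (i := i + 1) (w := p v) (fun y hy hy1 =>
        exists_unique_of_card_level (hlev (i + 1) (by omega)) hy hpvs' hy1 (by omega)) (by omega),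
        hlev (i + 1 + 1) (by omega)]
    have hc' : s'.card = i + 3 := by
      rw [Finset.card_eq_sum_card_fiberwise (f := h) (t := Finset.range (i + 3))
        (fun x hx => by have := hmax' x hx; simp; omega)]
      change ∑ b ∈ Finset.range (i + 3), (level h s' b).card = _
      rw [Finset.sum_congr rfl (fun a ha => hlev a (by have := Finset.mem_range.1 ha; omega))]
      simp
    have r1 := ih i (by omega) hs' ⟨v, hv, by omega⟩ hb'
    have hcs : s.card = i + 3 + m := by omega
    have hm0 : (m : ℝ) + 1 ≠ 0 := by positivity
    rw [hratio, r1, hd2, hcs, hc', broomRatio, broomRatio, broomSeq]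
    have e1 : ((i + 3 : ℕ) : ℝ) - i - 1 = 2 := by push_cast; ring
    have e2 : ((i + 3 + m : ℕ) : ℝ) - (i + 1 : ℕ) - 1 = m + 1 := by push_cast; ring
    rw [e1, e2]
    obtain rfl | hi := Nat.eq_zero_or_pos i
    · rw [hT.ratioOn_edge hs'' ⟨p v, hpvs, by omega⟩ hmax'']
      simp [broomSeq]
      field_simp
      ring
    · obtain ⟨l, rfl⟩ : ∃ l, i = l + 1 := ⟨i - 1, by omega⟩
      rw [ih l (by omega) hs'' ⟨p v, hpvs, by omega⟩ ⟨fun a ha _ => hlev'' a ha, hmax''⟩,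
        show (s'.erase v).card = l + 3 by omega, broomRatio, broomSeq]
      have e3 : ((l + 3 : ℕ) : ℝ) - l - 1 = 2 := by push_cast; ring
      rw [e3]
      push_cast
      field_simp
      ring

end IsRooted

end Bound

section Tree

lemma eq_of_adj_of_dist {T : SimpleGraph V} (hT : T.IsTree) {u x y z : V} (hy : T.Adj x y)
    (hz : T.Adj x z) (hdy : T.dist u x = T.dist u y + 1) (hdz : T.dist u x = T.dist u z + 1) :
    y = z := by
  obtain ⟨a, -, ha⟩ := hT.connected.exists_path_of_dist u y
  obtain ⟨b, -, hb⟩ := hT.connected.exists_path_of_dist u z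
  have ha' : (a.concat hy.symm).IsPath :=
    SimpleGraph.Walk.isPath_of_length_eq_dist _ (by rw [SimpleGraph.Walk.length_concat]; omega)
  have hb' : (b.concat hz.symm).IsPath :=
    SimpleGraph.Walk.isPath_of_length_eq_dist _ (by rw [SimpleGraph.Walk.length_concat]; omega)
  have e : a.concat hy.symm = b.concat hz.symm := (hT.existsUnique_path u x).unique ha' hb'
  have := congrArg SimpleGraph.Walk.penultimate e
  simpa using this

lemma exists_adj_dist_eq {T : SimpleGraph V} (hT : T.IsTree) {u x : V} (hx : x ≠ u) :
    ∃ y, T.Adj x y ∧ T.dist u x = T.dist u y + 1 := by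
  obtain ⟨a, -, ha⟩ := hT.connected.exists_path_of_dist x u
  cases a with
  | nil => exact absurd rfl hx
  | @cons _ y _ hadj q =>
    refine ⟨y, hadj, ?_⟩
    have h1 := SimpleGraph.dist_le q
    rw [SimpleGraph.Walk.length_cons, SimpleGraph.dist_comm] at ha
    rw [SimpleGraph.dist_comm] at h1
    rcases hT.dist_eq_dist_add_one_of_adj u hadj with h2 | h2 <;> omega

/-- A finite tree can be rooted at an endvertex of a longest path. -/
theorem exists_isRooted [Finite V] {T : SimpleGraph V} (hT : T.IsTree) {k : ℕ}
    (hdiam : ∃ u v, k ≤ T.dist u v) :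
    ∃ r p h, IsRooted T r p h ∧ ∃ x, k ≤ h x := by
  obtain ⟨u₀, v₀, h₀⟩ := hdiam
  have : Nonempty (V × V) := ⟨(u₀, v₀)⟩
  obtain ⟨⟨u, v⟩, hmax⟩ := Finite.exists_max (fun q : V × V => T.dist q.1 q.2)
  have hkuv : k ≤ T.dist u v := h₀.trans (hmax (u₀, v₀))
  have hex : ∀ x, ∃ y, x ≠ u → T.Adj x y ∧ T.dist u x = T.dist u y + 1 := fun x => by
    by_cases hx : x = u
    · exact ⟨x, fun hh => absurd hx hh⟩
    · obtain ⟨y, hy⟩ := exists_adj_dist_eq hT hx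
      exact ⟨y, fun _ => hy⟩
  choose p hp using hex
  have hpar : ∀ x y, T.Adj x y → T.dist u x = T.dist u y + 1 → x ≠ u ∧ p x = y := by
    intro x y hxy hd
    have hx : x ≠ u := by rintro rfl; simp at hd
    exact ⟨hx, eq_of_adj_of_dist hT (hp x hx).1 hxy (hp x hx).2 hd⟩
  refine ⟨u, p, T.dist u, ⟨by simp, fun x hx => (hp x hx).2, fun x y => ⟨fun hxy => ?_, ?_⟩, ?_⟩,
    v, hkuv⟩
  · rcases hT.dist_eq_dist_add_one_of_adj u hxy with h | h
    · exact Or.inl (hpar x y hxy h)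
    · exact Or.inr (hpar y x hxy.symm h)
  · rintro (⟨h1, h2⟩ | ⟨h1, h2⟩)
    · exact h2 ▸ (hp x h1).1
    · exact h2 ▸ (hp y h1).1.symm
  · have toward : ∀ x, T.dist u x = 1 → T.Adj u x ∧ T.dist v u = T.dist v x + 1 := fun x hx => by
      have hadj := SimpleGraph.dist_eq_one_iff_adj.1 hx
      refine ⟨hadj, (hT.dist_eq_dist_add_one_of_adj v hadj).resolve_right fun hh => ?_⟩
      have := hmax (v, x)
      simp only at this
      rw [hh, SimpleGraph.dist_comm] at this
      omega
    intro x y hx hy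
    exact eq_of_adj_of_dist hT (toward x hx).1 (toward y hy).1 (toward x hx).2 (toward y hy).2

lemma IsRooted.adj_of_height {T : SimpleGraph V} {r : V} {p : V → V} {h : V → ℕ}
    (hT : IsRooted T r p h) {x y : V} (hxy : T.Adj x y) :
    (h x = h y + 1 ∧ p x = y) ∨ (h y = h x + 1 ∧ p y = x) := by
  rcases (hT.adj_iff _ _).1 hxy with ⟨h1, h2⟩ | ⟨h1, h2⟩
  · exact Or.inl ⟨h2 ▸ hT.height_parent x h1, h2⟩
  · exact Or.inr ⟨h2 ▸ hT.height_parent y h1, h2⟩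

end Tree

section Broom

lemma broom_adj {n k : ℕ} (hk : 2 ≤ k) (i j : Fin n) : (broom n k).Adj i j ↔
    min (i : ℕ) k + 1 = min (j : ℕ) k ∨ min (j : ℕ) k + 1 = min (i : ℕ) k := by
  rw [broom, SimpleGraph.fromRel_adj, ne_eq, Fin.ext_iff]
  omega

lemma card_fiber_top {W : Type*} [Fintype W] {h : W → ℕ} {k : ℕ}
    (h1 : ∀ i < k, (Finset.univ.filter (fun x => h x = i)).card = 1) (hle : ∀ x, h x ≤ k) :
    (Finset.univ.filter (fun x => h x = k)).card = Fintype.card W - k := by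
  have := Finset.card_eq_sum_card_fiberwise (s := (Finset.univ : Finset W)) (f := h)
    (t := Finset.range (k + 1)) (fun x _ => by have := hle x; simp; omega)
  rw [Finset.sum_range_succ, Finset.sum_congr rfl (fun a ha => h1 a (Finset.mem_range.1 ha))] at this
  simp only [Finset.sum_const, Finset.card_range, Finset.card_univ] at this
  simp only [smul_eq_mul, mul_one] at this
  omega

/-- A graph with the same level structure as a broom is isomorphic to it. -/
lemma nonempty_iso_broom [Fintype V] {T : SimpleGraph V} {n k : ℕ} (hk : 2 ≤ k) (hn : k + 1 ≤ n)
    (hV : Fintype.card V = n) {h : V → ℕ} (hadj : ∀ x y, T.Adj x y ↔ h x + 1 = h y ∨ h y + 1 = h x)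
    (h1 : ∀ i < k, ∃! x, h x = i) (hle : ∀ x, h x ≤ k) : Nonempty (T ≃g broom n k) := by
  let H : Fin n → ℕ := fun i => min (i : ℕ) k
  have hc : ∀ i < k, (Finset.univ.filter (fun x => h x = i)).card = 1 := fun i hi => by
    obtain ⟨x, hx, hu⟩ := h1 i hi
    refine Finset.card_eq_one.2 ⟨x, ?_⟩
    ext y
    simp only [Finset.mem_filter, Finset.mem_univ, true_and, Finset.mem_singleton]
    exact ⟨hu y, fun e => e ▸ hx⟩
  have hC : ∀ i < k, (Finset.univ.filter (fun x => H x = i)).card = 1 := fun i hi => by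
    refine Finset.card_eq_one.2 ⟨⟨i, by omega⟩, ?_⟩
    ext y
    simp only [Finset.mem_filter, Finset.mem_univ, true_and, Finset.mem_singleton, Fin.ext_iff, H]
    omega
  have hLe : ∀ x, H x ≤ k := fun x => min_le_right _ _
  have hcard : ∀ i, Nonempty ({x // h x = i} ≃ {x // H x = i}) := fun i => by
    refine ⟨Fintype.equivOfCardEq ?_⟩
    rw [Fintype.card_subtype, Fintype.card_subtype]
    rcases lt_trichotomy i k with hi | rfl | hi
    · rw [hc i hi, hC i hi]
    · rw [card_fiber_top hc hle, card_fiber_top hC hLe, hV, Fintype.card_fin]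
    · rw [Finset.filter_eq_empty_iff.2 (fun x _ => by have := hle x; omega),
        Finset.filter_eq_empty_iff.2 (fun x _ => by have := hLe x; omega)]
      rfl
  let e := Equiv.ofFiberEquiv (fun i => (hcard i).some)
  have he : ∀ x, H (e x) = h x := fun x => Equiv.ofFiberEquiv_map _ x
  refine ⟨⟨e, fun {x y} => ?_⟩⟩
  rw [broom_adj hk, hadj, ← he, ← he]

variable [Fintype V] {T : SimpleGraph V} {r : V} {p : V → V} {h : V → ℕ} {n k : ℕ}

lemma BroomLevels.existsUnique {j i : ℕ} (hb : BroomLevels h Finset.univ k j) (hi : i ≤ k)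
    (hij : i ≠ j) : ∃! x, h x = i := by
  obtain ⟨x, hx⟩ := Finset.card_eq_one.1 (hb.1 i hi hij)
  refine ⟨x, (mem_level.1 (hx ▸ Finset.mem_singleton_self x)).2, fun y hy => ?_⟩
  exact Finset.mem_singleton.1 (hx ▸ mem_level.2 ⟨Finset.mem_univ y, hy⟩)

namespace IsRooted

lemma iso_broom_of_last_level (hT : IsRooted T r p h) (hk : 2 ≤ k) (hn : k + 1 ≤ n)
    (hV : Fintype.card V = n) (hb : BroomLevels h Finset.univ k k) :
    Nonempty (T ≃g broom n k) := by
  have hle : ∀ x, h x ≤ k := fun x => hb.2 x (Finset.mem_univ x)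
  have hu : ∀ i < k, ∃! x, h x = i := fun i hi => hb.existsUnique hi.le hi.ne
  have hpar : ∀ x y, h x + 1 = h y → T.Adj y x := fun x y hxy => by
    have hy : y ≠ r := hT.ne_root (by omega)
    have h1 := hT.height_parent y hy
    have h2 := hle y
    have : p y = x := (hu (h x) (by omega)).unique (by omega) rfl
    exact this ▸ hT.adj_parent hy
  refine nonempty_iso_broom hk hn hV (fun x y => ⟨fun hxy => ?_, ?_⟩) hu hle
  · rcases hT.adj_of_height hxy with h1 | h1 <;> omega
  · rintro (h1 | h1)
    · exact (hpar x y h1).symm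
    · exact hpar y x h1

lemma iso_broom_of_second_level (hT : IsRooted T r p h) (hk : 3 ≤ k) (hn : k + 1 ≤ n)
    (hV : Fintype.card V = n) (hb : BroomLevels h Finset.univ k 2) :
    Nonempty (T ≃g broom n k) := by
  have hle : ∀ x, h x ≤ k := fun x => hb.2 x (Finset.mem_univ x)
  have hu : ∀ i ≤ k, i ≠ 2 → ∃! x, h x = i := fun i hi hi2 => hb.existsUnique hi hi2
  obtain ⟨t, ht, htu⟩ := hu 3 hk (by norm_num)
  have htp := hT.height_parent t (hT.ne_root (by omega))
  obtain ⟨z, hz⟩ : ∃ z, p t = z := ⟨_, rfl⟩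
  have hz2 : h z = 2 := by rw [hz] at htp; omega
  let g : V → ℕ := fun x => if h x = 2 ∧ x ≠ z then k else k - h x
  have g1 : ∀ x, h x = 2 → x ≠ z → g x = k := fun x h1 h2 => if_pos ⟨h1, h2⟩
  have g2 : ∀ x, ¬ (h x = 2 ∧ x ≠ z) → g x = k - h x := fun x h1 => if_neg h1
  have hgpar : ∀ x y, h x = h y + 1 → p x = y → g x + 1 = g y ∨ g y + 1 = g x := by
    intro x y h1 h2
    have h3 := hle x
    by_cases hx : h x = 2 ∧ x ≠ z
    · rw [g1 x hx.1 hx.2, g2 y (by omega)]; omega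
    · have hy : ¬ (h y = 2 ∧ y ≠ z) := by
        rintro ⟨h4, h5⟩
        rw [htu x (by show h x = 3; omega), hz] at h2
        exact h5 h2.symm
      rw [g2 x hx, g2 y hy]; omega
  have hgadj : ∀ x y, g x + 1 = g y → T.Adj x y := by
    intro x y hxy
    have h3 := hle x
    have h4 := hle y
    by_cases hx : h x = 2 ∧ x ≠ z
    · rw [g1 x hx.1 hx.2] at hxy
      by_cases hy : h y = 2 ∧ y ≠ z
      · rw [g1 y hy.1 hy.2] at hxy; omega
      · rw [g2 y hy] at hxy; omega
    rw [g2 x hx] at hxy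
    by_cases hy : h y = 2 ∧ y ≠ z
    · rw [g1 y hy.1 hy.2] at hxy
      have hyr : y ≠ r := hT.ne_root (by omega)
      have h5 := hT.height_parent y hyr
      have : p y = x := (hu 1 (by omega) (by norm_num)).unique (by omega) (by omega)
      exact this ▸ (hT.adj_parent hyr).symm
    · rw [g2 y hy] at hxy
      have hxr : x ≠ r := hT.ne_root (by omega)
      have h5 := hT.height_parent x hxr
      have : p x = y := by
        by_cases hy2 : h y = 2
        · have hyz : y = z := by by_contra hh; exact hy ⟨hy2, hh⟩
          rw [htu x (by show h x = 3; omega), hz, hyz]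
        · exact (hu (h y) h4 hy2).unique (by omega) rfl
      exact this ▸ hT.adj_parent hxr
  refine nonempty_iso_broom (h := g) (by omega) hn hV (fun x y => ⟨fun hxy => ?_, ?_⟩)
    (fun i hi => ?_) (fun x => ?_)
  · rcases hT.adj_of_height hxy with ⟨h1, h2⟩ | ⟨h1, h2⟩
    · exact hgpar x y h1 h2
    · exact (hgpar y x h1 h2).symm
  · rintro (h1 | h1)
    · exact hgadj x y h1
    · exact (hgadj y x h1).symm
  · have key : ∀ x, g x = i → h x = k - i ∧ (h x = 2 → x = z) := by
      intro x hx
      by_cases hs : h x = 2 ∧ x ≠ z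
      · rw [g1 x hs.1 hs.2] at hx; omega
      · rw [g2 x hs] at hx
        have := hle x
        exact ⟨by omega, fun h2 => by by_contra hh; exact hs ⟨h2, hh⟩⟩
    by_cases hi2 : k - i = 2
    · refine ⟨z, ?_, fun y hy => (key y hy).2 ((key y hy).1.trans hi2)⟩
      change g z = i
      rw [g2 z (fun hh => hh.2 rfl)]; omega
    · obtain ⟨x, hx, hxu⟩ := hu (k - i) (by omega) hi2
      refine ⟨x, ?_, fun y hy => hxu y (key y hy).1⟩
      change g x = i
      have hx' : h x = k - i := hx
      rw [g2 x (by omega)]; omega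
  · by_cases hs : h x = 2 ∧ x ≠ z
    · rw [g1 x hs.1 hs.2]
    · rw [g2 x hs]; omega

end IsRooted

lemma exists_isRooted_of_iso (hk : 2 ≤ k) (hn : k + 1 ≤ n) (φ : T ≃g broom n k) :
    ∃ r p h, IsRooted T r p h ∧ (∃ x, h x = k) ∧ BroomLevels h Finset.univ k k := by
  let q : V → Fin n := fun x => ⟨if (φ x : ℕ) < k then (φ x : ℕ) - 1 else k - 1, by
    have := (φ x).2; split_ifs <;> omega⟩
  have hq : ∀ x, (q x : ℕ) = if (φ x : ℕ) < k then (φ x : ℕ) - 1 else k - 1 := fun x => rfl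
  have hroot : ∀ x, x ≠ φ.symm ⟨0, by omega⟩ ↔ (φ x : ℕ) ≠ 0 := fun x => by
    rw [ne_eq, ← φ.injective.eq_iff, φ.apply_symm_apply, Fin.ext_iff]
  have hpar : ∀ x y, φ.symm (q x) = y ↔ (q x : ℕ) = φ y := fun x y => by
    rw [← φ.injective.eq_iff, φ.apply_symm_apply, Fin.ext_iff]
  refine ⟨φ.symm ⟨0, by omega⟩, fun x => φ.symm (q x), fun x => min (φ x : ℕ) k,
    ⟨?_, fun x hx => ?_, fun x y => ?_, fun x y hx hy => ?_⟩, ?_, fun i hi hik => ?_,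
    fun x _ => min_le_right _ _⟩
  · simp
  · rw [hroot] at hx
    simp only [φ.apply_symm_apply, hq]
    split_ifs <;> omega
  · rw [← φ.map_adj_iff, broom_adj hk, hroot, hroot, hpar, hpar, hq, hq]
    split_ifs <;> omega
  · apply φ.injective
    rw [Fin.ext_iff]
    omega
  · exact ⟨φ.symm ⟨k, by omega⟩, by simp⟩
  · refine Finset.card_eq_one.2 ⟨φ.symm ⟨i, by omega⟩, ?_⟩
    ext y
    rw [mem_level, Finset.mem_singleton, ← φ.injective.eq_iff, φ.apply_symm_apply, Fin.ext_iff]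
    simp only [Finset.mem_univ, true_and]
    omega

end Broom

lemma ratioOn_univ [Fintype V] (T : SimpleGraph V) : ratioOn T Finset.univ = lapRatio T := by
  have hd : ∀ x, degIn T Finset.univ x = T.degree x := fun x => by
    rw [degIn, ← SimpleGraph.card_neighborFinset_eq_degree, SimpleGraph.neighborFinset_eq_filter]
  have hM : matrixRestrict (weightedLap T (fun x => degIn T Finset.univ x)) Finset.univ =
      T.lapMatrix ℝ := by
    ext i j
    simp only [matrixRestrict, weightedLap, Finset.mem_univ, and_self, if_true, hd,
      SimpleGraph.lapMatrix, SimpleGraph.degMatrix, Matrix.sub_apply, Matrix.diagonal_apply,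
      SimpleGraph.adjMatrix_apply]
    by_cases hij : i = j
    · subst hij; simp
    · by_cases ha : T.Adj i j <;> simp [hij, ha]
  rw [ratioOn, subPerm, hM, lapRatio, permL, PD]
  simp only [hd]

lemma isSubtree_univ [Fintype V] (r : V) (p : V → V) : IsSubtree r p Finset.univ :=
  ⟨Finset.mem_univ _, fun _ _ _ => Finset.mem_univ _⟩

end Auxiliary

/-- main theorem: among trees on `n` vertices with diameter at least `k`,
the broom `B(n,k)` uniquely minimizes the Laplacian ratio, whose minimum value is
`[1+√2−√2/(2(n−k+1))]·((1+√2)/2)^(k−2) + [1−√2+√2/(2(n−k+1))]·((1−√2)/2)^(k−2)`. -/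
theorem lapRatio_ge_of_diam_ge {V : Type*} [Fintype V] (n k : ℕ) (hk : 2 ≤ k)
    (hn : k + 1 ≤ n) (hV : Fintype.card V = n) (T : SimpleGraph V) (hT : T.IsTree)
    (hdiam : ∃ u v : V, k ≤ T.dist u v) :
    ((1 + Real.sqrt 2 - Real.sqrt 2 / (2 * ((n : ℝ) - (k : ℝ) + 1))) *
        ((1 + Real.sqrt 2) / 2) ^ (k - 2) +
      (1 - Real.sqrt 2 + Real.sqrt 2 / (2 * ((n : ℝ) - (k : ℝ) + 1))) *
        ((1 - Real.sqrt 2) / 2) ^ (k - 2)) ≤ lapRatio T ∧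
    (lapRatio T =
      (1 + Real.sqrt 2 - Real.sqrt 2 / (2 * ((n : ℝ) - (k : ℝ) + 1))) *
        ((1 + Real.sqrt 2) / 2) ^ (k - 2) +
      (1 - Real.sqrt 2 + Real.sqrt 2 / (2 * ((n : ℝ) - (k : ℝ) + 1))) *
        ((1 - Real.sqrt 2) / 2) ^ (k - 2) ↔
      Nonempty (T ≃g broom n k)) := by
  obtain ⟨j, rfl⟩ : ∃ j, k = j + 2 := ⟨k - 2, by omega⟩
  have e : (n : ℝ) - ((j + 2 : ℕ) : ℝ) + 1 = (n : ℝ) - j - 1 := by push_cast; ring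
  have hcard : (Finset.univ : Finset V).card = n := by rw [Finset.card_univ, hV]
  rw [e, Nat.add_sub_cancel, ← broomRatio_eq, ← ratioOn_univ]
  obtain ⟨r, p, h, hR, x, hx⟩ := exists_isRooted hT hdiam
  obtain ⟨hle, heq⟩ := hR.broomRatio_le_ratioOn (isSubtree_univ r p) ⟨x, Finset.mem_univ x, hx⟩
  rw [hcard] at hle heq
  refine ⟨hle, fun hh => ?_, fun ⟨φ⟩ => ?_⟩
  · rcases heq hh with hb | hb
    · exact hR.iso_broom_of_last_level hk hn hV hb
    · obtain rfl | hj := Nat.eq_zero_or_pos j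
      · exact hR.iso_broom_of_last_level hk hn hV hb
      · exact hR.iso_broom_of_second_level (by omega) hn hV hb
  · obtain ⟨r', p', h', hR', ⟨y, hy⟩, hb⟩ := exists_isRooted_of_iso hk hn φ
    rw [hR'.ratioOn_of_broomLevels (isSubtree_univ r' p') ⟨y, Finset.mem_univ y, hy⟩ hb, hcard]
end

section
/- Let G be a simple graph and let v be a vertex of G with degree d(v). Then per L(G) = d(v)·per L_v(G) + Σ_{u∈N(v)} per L_{vu}(G) + 2·Σ_{C∈𝒞_G(v)} (−1)^{|V(C)|}·per L_{V(C)}(G), where N(v) is the neighborhood of v and 𝒞_G(v) is the set of cycles of G (as subgraphs) passing through v. -/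
open scoped Classical

/-- Permanent of the principal submatrix of the Laplacian of `G` obtained by deleting the
rows and columns indexed by vertices in `S`. -/
noncomputable def permDel {V : Type*} [Fintype V] (G : SimpleGraph V) (S : Set V) : ℝ :=
  ((G.lapMatrix ℝ).submatrix (fun i : ↥(Sᶜ) => (i : V)) (fun i : ↥(Sᶜ) => (i : V))).permanent

/-- A subgraph is a cycle subgraph if it is the subgraph traced out by some cycle walk. -/
def IsCycleSubgraph {V : Type*} (G : SimpleGraph V) (C : G.Subgraph) : Prop :=
  ∃ (x : V) (w : G.Walk x x), w.IsCycle ∧ w.toSubgraph = C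

/-- The part of the permanent coming from the permutations that agree with `c` on `S`. -/
theorem sum_perm_agree_eq {V R : Type*} [Fintype V] [CommRing R] (M : Matrix V V R)
    (c : Equiv.Perm V) (S : Set V) (hS : ∀ a ∉ S, c a = a) :
    ∑ σ : Equiv.Perm V with ∀ a ∈ S, σ a = c a, ∏ i, M (σ i) i =
      (∏ i ∈ S.toFinset, M (c i) i) *
        (M.submatrix (fun i : ↥(Sᶜ) => (i : V)) (fun i : ↥(Sᶜ) => (i : V))).permanent := by
  rw [Matrix.permanent, Finset.mul_sum]
  symm
  refine Finset.sum_bij (fun τ _ => c * Equiv.Perm.ofSubtype τ) ?_ ?_ ?_ ?_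
  · intro τ _
    simp only [Finset.mem_filter, Finset.mem_univ, true_and, Equiv.Perm.mul_apply]
    intro a ha
    rw [Equiv.Perm.ofSubtype_apply_of_not_mem _ (by simpa using ha)]
  · intro τ _ τ' _ h
    exact Equiv.Perm.ofSubtype_injective (mul_left_cancel h)
  · intro σ hσ
    simp only [Finset.mem_filter, Finset.mem_univ, true_and] at hσ
    have hfix : ∀ a ∈ S, (c⁻¹ * σ) a = a := fun a ha => by
      rw [Equiv.Perm.mul_apply, hσ a ha, ← Equiv.Perm.mul_apply, inv_mul_cancel, Equiv.Perm.one_apply]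
    have hmem : ∀ a, (c⁻¹ * σ) a ∈ Sᶜ ↔ a ∈ Sᶜ := fun a => by
      refine not_congr ⟨fun h => ?_, fun h => (hfix a h).symm ▸ h⟩
      have := (c⁻¹ * σ).injective (hfix _ h)
      exact this ▸ h
    refine ⟨(c⁻¹ * σ).subtypePerm hmem, Finset.mem_univ _, ?_⟩
    rw [Equiv.Perm.ofSubtype_subtypePerm]
    · simp
    · intro a ha haS
      exact ha (hfix a haS)
  · intro τ _
    rw [← Finset.prod_mul_prod_compl S.toFinset (fun i => M ((c * Equiv.Perm.ofSubtype τ) i) i)]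
    congr 1
    · refine Finset.prod_congr rfl fun i hi => ?_
      rw [Equiv.Perm.mul_apply, Equiv.Perm.ofSubtype_apply_of_not_mem _ (by simpa using hi)]
    · rw [← Set.toFinset_compl, ← Finset.prod_coe_sort Sᶜ.toFinset]
      refine (Fintype.prod_equiv (Equiv.subtypeEquivRight (by simp)) _ _ ?_)
      intro i
      simp only [Matrix.submatrix_apply, Equiv.subtypeEquivRight_apply_coe, Equiv.Perm.mul_apply,
        Equiv.Perm.ofSubtype_apply_coe]
      rw [hS _ (τ i).2]

/-- The subgraph of `G` formed by the edges `{a, c a}` for a permutation `c`. -/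
def permSubgraph {V : Type*} [Fintype V] (G : SimpleGraph V) (c : Equiv.Perm V) : G.Subgraph where
  verts := c.support
  Adj a b := G.Adj a b ∧ (c a = b ∨ c b = a)
  adj_sub h := h.1
  edge_vert := by
    rintro a b ⟨h, hc⟩
    simp only [Finset.mem_coe, Equiv.Perm.mem_support]
    intro ha
    rcases hc with hc | hc
    · exact h.ne (ha.symm.trans hc)
    · exact h.ne (c.injective (ha.trans hc.symm))
  symm := ⟨fun _ _ h => ⟨h.1.symm, h.2.symm⟩⟩

theorem permSubgraph_inv {V : Type*} [Fintype V] (G : SimpleGraph V) (c : Equiv.Perm V) :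
    permSubgraph G c⁻¹ = permSubgraph G c := by
  ext a b
  · simp [permSubgraph]
  · simp only [permSubgraph, Equiv.Perm.inv_eq_iff_eq]
    grind

theorem apply_ne_symm_apply_of_three_le {V : Type*} [Fintype V] {c : Equiv.Perm V}
    (hc : c.IsCycle) (h3 : 3 ≤ c.support.card) {a : V} (ha : a ∈ c.support) :
    c a ≠ c.symm a := by
  intro h
  have h2 : c (c a) = a := by rw [h]; simp
  have hs : c = Equiv.swap a (c a) :=
    hc.eq_swap_of_apply_apply_eq_self (Equiv.Perm.mem_support.1 ha) h2
  have : c.support.card = 2 := by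
    rw [hs]
    exact Equiv.Perm.card_support_swap (Equiv.Perm.mem_support.1 ha).symm
  omega

theorem neighborSet_permSubgraph {V : Type*} [Fintype V] {G : SimpleGraph V} {c : Equiv.Perm V}
    (hG : ∀ a ∈ c.support, G.Adj a (c a)) {a : V} (ha : a ∈ c.support) :
    (permSubgraph G c).neighborSet a = {c a, c.symm a} := by
  ext b
  simp only [SimpleGraph.Subgraph.mem_neighborSet, permSubgraph, Set.mem_insert_iff,
    Set.mem_singleton_iff, Equiv.eq_symm_apply]
  constructor
  · rintro ⟨-, h⟩
    grind
  · rintro (rfl | h)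
    · exact ⟨hG a ha, .inl rfl⟩
    · refine ⟨?_, .inr h⟩
      have := hG b (by rw [Equiv.Perm.mem_support] at *; rintro h'; grind)
      rw [h] at this
      exact this.symm

/-- A cycle on the support of `c` that contains, or is contained in, the graph of edges
`{a, c a}` is equal to it. -/
theorem toSubgraph_eq_permSubgraph {V : Type*} [Fintype V] {G : SimpleGraph V}
    {c : Equiv.Perm V} (hc : c.IsCycle) (h3 : 3 ≤ c.support.card)
    (hG : ∀ a ∈ c.support, G.Adj a (c a)) {x : V} {w : G.Walk x x} (hw : w.IsCycle)
    (hV : w.toSubgraph.verts = c.support)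
    (h : w.toSubgraph ≤ permSubgraph G c ∨ permSubgraph G c ≤ w.toSubgraph) :
    w.toSubgraph = permSubgraph G c := by
  refine SimpleGraph.Subgraph.ext (by exact hV) ?_
  have key : ∀ a ∈ c.support,
      w.toSubgraph.neighborSet a = (permSubgraph G c).neighborSet a := by
    intro a ha
    have h1 : (w.toSubgraph.neighborSet a).ncard = 2 :=
      hw.ncard_neighborSet_toSubgraph_eq_two
        (by rw [← SimpleGraph.Walk.mem_verts_toSubgraph, hV]; exact ha)
    have h2 : ((permSubgraph G c).neighborSet a).ncard = 2 := by
      rw [neighborSet_permSubgraph hG ha,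
        Set.ncard_pair (apply_ne_symm_apply_of_three_le hc h3 ha)]
    rcases h with h | h
    · exact Set.eq_of_subset_of_ncard_le (fun b hb => h.2 hb) (h2.trans h1.symm).le
    · exact (Set.eq_of_subset_of_ncard_le (fun b hb => h.2 hb) (h1.trans h2.symm).le).symm
  ext a b
  constructor
  · intro hab
    have ha : a ∈ c.support := by 
      have := w.toSubgraph.edge_vert hab
      rwa [hV] at this
    exact (Set.ext_iff.1 (key a ha) b).1 hab
  · intro hab
    exact (Set.ext_iff.1 (key a ((permSubgraph G c).edge_vert hab)) b).2 hab

theorem isCycleSubgraph_permSubgraph {V : Type*} [Fintype V] {G : SimpleGraph V}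
    {c : Equiv.Perm V} (hc : c.IsCycle) (h3 : 3 ≤ c.support.card)
    (hG : ∀ a ∈ c.support, G.Adj a (c a)) : IsCycleSubgraph G (permSubgraph G c) := by
  obtain ⟨v, hv⟩ := hc.nonempty_support
  let H : SimpleGraph V := (permSubgraph G c).spanningCoe
  have hHG : H ≤ G := SimpleGraph.Subgraph.spanningCoe_le _
  have hstep : ∀ a ∈ c.support, H.Adj a (c a) := fun a ha => ⟨hG a ha, .inl rfl⟩
  have hnb : ∀ a, H.neighborSet a = (permSubgraph G c).neighborSet a := fun a => rfl
  have hcyc : H.IsCycles := by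
    rintro a ⟨b, hab⟩
    have ha : a ∈ c.support := (permSubgraph G c).edge_vert hab
    rw [hnb, neighborSet_permSubgraph hG ha,
      Set.ncard_pair (apply_ne_symm_apply_of_three_le hc h3 ha)]
  obtain ⟨p, hp, hpv⟩ := hcyc.exists_cycle_toSubgraph_verts_eq_connectedComponentSupp
    (c := H.connectedComponentMk v) rfl ⟨c v, hstep v hv⟩
  have hverts : (H.connectedComponentMk v).supp = c.support := by
    ext a
    rw [SimpleGraph.ConnectedComponent.mem_supp_iff, SimpleGraph.ConnectedComponent.eq]
    constructor
    · rintro ⟨q⟩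
      cases q with
      | nil => exact hv
      | cons h q => exact (permSubgraph G c).edge_vert h
    · intro ha
      obtain ⟨n, rfl⟩ := hc.exists_pow_eq (Equiv.Perm.mem_support.1 hv)
        (Equiv.Perm.mem_support.1 (Finset.mem_coe.1 ha))
      clear ha
      induction n with
      | zero => exact .refl _
      | succ n ih =>
        rw [pow_succ', Equiv.Perm.mul_apply]
        exact (hstep _ (by simpa using hv)).reachable.symm.trans ih
  have hsub : (p.mapLe hHG).toSubgraph = permSubgraph G c := by
    refine toSubgraph_eq_permSubgraph hc h3 hG (hp.mapLe hHG) ?_ (.inl ⟨?_, ?_⟩)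
    · ext a
      rw [← hverts, ← hpv, SimpleGraph.Walk.mem_verts_toSubgraph,
        SimpleGraph.Walk.mem_verts_toSubgraph]
      simp
    · intro a
      rw [SimpleGraph.Walk.mem_verts_toSubgraph, SimpleGraph.Walk.support_mapLe_eq_support,
        ← SimpleGraph.Walk.mem_verts_toSubgraph, hpv, hverts]
      exact id
    · intro a b hab
      rw [SimpleGraph.Walk.adj_toSubgraph_iff_mem_edges, SimpleGraph.Walk.edges_mapLe_eq_edges] at hab
      exact p.adj_of_mem_edges hab
  exact ⟨v, p.mapLe hHG, hp.mapLe hHG, hsub⟩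

theorem exists_eq_permSubgraph {V : Type*} [Fintype V] {G : SimpleGraph V} {C : G.Subgraph}
    (hC : IsCycleSubgraph G C) : ∃ c : Equiv.Perm V, c.IsCycle ∧ 3 ≤ c.support.card ∧
      (∀ a ∈ c.support, G.Adj a (c a)) ∧ permSubgraph G c = C := by
  obtain ⟨x, w, hw, rfl⟩ := hC
  set l := w.support.tail with hl
  have hnd : l.Nodup := hw.support_nodup
  have hlen : l.length = w.length := by simp [hl]
  have h3 : 3 ≤ l.length := hlen ▸ hw.three_le_length
  have hget : ∀ i (hi : i < l.length), l[i] = w.getVert (i + 1) := by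
    intro i hi
    simp [hl, SimpleGraph.Walk.getVert_eq_support_getElem _ (show i + 1 ≤ w.length by omega)]
  have hadj : ∀ a ∈ l, w.toSubgraph.Adj a (l.formPerm a) := by
    intro a ha
    obtain ⟨i, hi, rfl⟩ := List.getElem_of_mem ha
    rw [List.formPerm_apply_getElem _ hnd, hget, hget]
    rcases Nat.lt_or_ge (i + 1) l.length with h | h
    · rw [Nat.mod_eq_of_lt h]
      exact w.toSubgraph_adj_getVert (by omega)
    · have h' : i + 1 = l.length := by omega
      rw [h', Nat.mod_self, hlen, w.getVert_length]
      simpa using w.toSubgraph_adj_getVert (i := 0) (by omega)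
  have hsupp : l.formPerm.support = l.toFinset :=
    List.support_formPerm_of_nodup l hnd (by rintro y h; simp [h] at h3)
  have hcyc : l.formPerm.IsCycle := List.isCycle_formPerm hnd (by omega)
  have hcard : 3 ≤ l.formPerm.support.card := by
    rwa [hsupp, List.toFinset_card_of_nodup hnd]
  have hadj' : ∀ a ∈ l.formPerm.support, w.toSubgraph.Adj a (l.formPerm a) := fun a ha =>
    hadj a (by simpa [hsupp] using ha)
  have hG : ∀ a ∈ l.formPerm.support, G.Adj a (l.formPerm a) := fun a ha => (hadj' a ha).adj_sub
  have hV : w.toSubgraph.verts = l.formPerm.support := by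
    ext a
    rw [SimpleGraph.Walk.mem_verts_toSubgraph, hsupp, List.coe_toFinset]
    change _ ↔ a ∈ l
    rw [← w.cons_tail_support, List.mem_cons, or_iff_right_iff_imp]
    rintro rfl
    exact SimpleGraph.Walk.end_mem_tail_support hw.not_nil
  refine ⟨l.formPerm, hcyc, hcard, hG,
    (toSubgraph_eq_permSubgraph hcyc hcard hG hw hV (.inr ⟨by exact hV.ge, ?_⟩)).symm⟩
  rintro a b ⟨hab, h | h⟩
  · subst h
    exact hadj' a (by simpa using hab.ne')
  · subst h
    exact (hadj' b (by simpa using hab.ne)).symm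

theorem adj_inv_apply {V : Type*} [Fintype V] {G : SimpleGraph V} {c : Equiv.Perm V}
    (hG : ∀ a ∈ c.support, G.Adj a (c a)) : ∀ a ∈ c⁻¹.support, G.Adj a (c⁻¹ a) := by
  intro a ha
  rw [Equiv.Perm.support_inv, Equiv.Perm.mem_support] at ha
  have h := hG (c.symm a) (by
    rw [Equiv.Perm.mem_support, Equiv.apply_symm_apply]
    intro h
    exact ha (by nth_rw 1 [h]; simp))
  rw [Equiv.apply_symm_apply] at h
  exact h.symm

theorem eq_of_permSubgraph_eq {V : Type*} [Fintype V] {G : SimpleGraph V} {c d : Equiv.Perm V}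
    (hc : c.IsCycle) (hcG : ∀ a ∈ c.support, G.Adj a (c a))
    (h3 : 3 ≤ c.support.card)
    (hdG : ∀ a ∈ d.support, G.Adj a (d a)) (h : permSubgraph G d = permSubgraph G c)
    {v : V} (hv : v ∈ c.support) (hdv : d v = c v) : d = c := by
  have hsupp : d.support = c.support :=
    Finset.coe_injective (congrArg SimpleGraph.Subgraph.verts h)
  have hpair : ∀ a ∈ c.support, ({d a, d.symm a} : Set V) = {c a, c.symm a} := fun a ha => by
    rw [← neighborSet_permSubgraph hcG ha, ← h, neighborSet_permSubgraph hdG (hsupp ▸ ha)]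
  have hpow : ∀ n : ℕ, d ((c ^ n) v) = c ((c ^ n) v) := by
    intro n
    induction n with
    | zero => exact hdv
    | succ n ih =>
      have hb : (c ^ (n + 1)) v ∈ c.support := by simpa using hv
      have hp := hpair _ hb
      have hne := apply_ne_symm_apply_of_three_le hc h3 hb
      have e1 : c.symm ((c ^ (n + 1)) v) = (c ^ n) v := by
        rw [pow_succ', Equiv.Perm.mul_apply, Equiv.symm_apply_apply]
      have e2 : d.symm ((c ^ (n + 1)) v) = (c ^ n) v := by
        rw [pow_succ', Equiv.Perm.mul_apply, ← ih, Equiv.symm_apply_apply]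
      rw [e1] at hp hne
      rw [e2] at hp
      have : c ((c ^ (n + 1)) v) ∈ ({d ((c ^ (n + 1)) v), (c ^ n) v} : Set V) := by
        rw [hp]; simp
      rcases this with h | h
      · exact h.symm
      · exact absurd h hne
  ext a
  by_cases ha : a ∈ c.support
  · obtain ⟨n, rfl⟩ := hc.exists_pow_eq (Equiv.Perm.mem_support.1 hv) (Equiv.Perm.mem_support.1 ha)
    exact hpow n
  · rw [Equiv.Perm.notMem_support.1 ha, Equiv.Perm.notMem_support.1 (hsupp ▸ ha)]

theorem permSubgraph_eq_iff {V : Type*} [Fintype V] {G : SimpleGraph V} {c d : Equiv.Perm V}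
    (hc : c.IsCycle) (hcG : ∀ a ∈ c.support, G.Adj a (c a)) (h3 : 3 ≤ c.support.card)
    (hdG : ∀ a ∈ d.support, G.Adj a (d a)) :
    permSubgraph G d = permSubgraph G c ↔ d = c ∨ d = c⁻¹ := by
  constructor
  · intro h
    obtain ⟨v, hv⟩ := hc.nonempty_support
    have hsupp : d.support = c.support :=
      Finset.coe_injective (congrArg SimpleGraph.Subgraph.verts h)
    have hpair : ({d v, d.symm v} : Set V) = {c v, c.symm v} := by
      rw [← neighborSet_permSubgraph hcG hv, ← h, neighborSet_permSubgraph hdG (hsupp ▸ hv)]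
    have hmem : d v ∈ ({c v, c.symm v} : Set V) := by rw [← hpair]; simp
    rcases hmem with hdv | hdv
    · exact .inl (eq_of_permSubgraph_eq hc hcG h3 hdG h hv hdv)
    · exact .inr (eq_of_permSubgraph_eq hc.inv (adj_inv_apply hcG) (by simpa using h3) hdG
        (h.trans (permSubgraph_inv G c).symm) (v := v) (by simpa using hv) hdv)
  · rintro (rfl | rfl)
    · rfl
    · exact permSubgraph_inv G c

theorem lapMatrix_apply_self {V : Type*} [Fintype V] (G : SimpleGraph V) (v : V) :
    G.lapMatrix ℝ v v = G.degree v := by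
  simp [SimpleGraph.lapMatrix, SimpleGraph.degMatrix]

theorem lapMatrix_apply_of_ne {V : Type*} [Fintype V] (G : SimpleGraph V) {u v : V} (h : u ≠ v) :
    G.lapMatrix ℝ u v = if G.Adj u v then -1 else 0 := by
  simp only [SimpleGraph.lapMatrix, SimpleGraph.degMatrix, Matrix.sub_apply,
    Matrix.diagonal_apply_ne _ h, SimpleGraph.adjMatrix_apply]
  split_ifs <;> simp

theorem prod_support_lapMatrix {V : Type*} [Fintype V] (G : SimpleGraph V) (c : Equiv.Perm V) :
    ∏ i ∈ c.support, G.lapMatrix ℝ (c i) i =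
      if ∀ a ∈ c.support, G.Adj a (c a) then (-1) ^ c.support.card else 0 := by
  have hL : ∀ i ∈ c.support,
      G.lapMatrix ℝ (c i) i = if G.Adj i (c i) then -1 else 0 := fun i hi => by
    rw [lapMatrix_apply_of_ne G (Equiv.Perm.mem_support.1 hi)]
    simp only [G.adj_comm]
  rw [Finset.prod_congr rfl hL]
  split_ifs with h
  · rw [Finset.prod_congr rfl fun i hi => if_pos (h i hi), Finset.prod_const]
  · push Not at h
    obtain ⟨a, ha, hna⟩ := h
    exact Finset.prod_eq_zero ha (if_neg hna)

theorem cycleOf_eq_iff_agree {V : Type*} [Fintype V] {c σ : Equiv.Perm V} {v : V}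
    (hc : c.IsCycle) (hv : v ∈ c.support) :
    (σ v ≠ v ∧ σ.cycleOf v = c) ↔ ∀ a ∈ c.support, σ a = c a := by
  constructor
  · rintro ⟨hσ, rfl⟩ a ha
    have h := Equiv.Perm.cycleOf_mem_cycleFactorsFinset_iff.2 (Equiv.Perm.mem_support.2 hσ)
    exact ((Equiv.Perm.mem_cycleFactorsFinset_iff.1 h).2 a ha).symm
  · intro h
    refine ⟨by rw [h v hv]; exact Equiv.Perm.mem_support.1 hv, ?_⟩
    exact (Equiv.Perm.cycle_is_cycleOf hv
      (Equiv.Perm.mem_cycleFactorsFinset_iff.2 ⟨hc, fun a ha => (h a ha).symm⟩)).symm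

/-- Cyclic permutations through `v` that move every vertex of their support along an edge. -/
noncomputable def adjCycles {V : Type*} [Fintype V] (G : SimpleGraph V) (v : V) :
    Finset (Equiv.Perm V) :=
  {c | c.IsCycle ∧ v ∈ c.support ∧ ∀ a ∈ c.support, G.Adj a (c a)}

theorem permL_eq_add_sum_adjCycles {V : Type*} [Fintype V] (G : SimpleGraph V) (v : V) :
    permL G = (G.degree v : ℝ) * permDel G {v} +
      ∑ c ∈ adjCycles G v, (-1) ^ c.support.card * permDel G c.support := by
  rw [permL, Matrix.permanent,
    ← Finset.sum_filter_add_sum_filter_not Finset.univ (fun σ : Equiv.Perm V => σ v = v)]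
  congr 1
  · have h := sum_perm_agree_eq (G.lapMatrix ℝ) 1 {v} (by simp)
    simp only [Set.mem_singleton_iff, forall_eq, Equiv.Perm.one_apply, Set.toFinset_singleton,
      Finset.prod_singleton, lapMatrix_apply_self] at h
    exact h
  · rw [← Finset.sum_fiberwise_of_maps_to (g := fun σ => σ.cycleOf v)
      (t := {c : Equiv.Perm V | c.IsCycle ∧ v ∈ c.support})]
    · have hsum : ∀ c ∈ ({c : Equiv.Perm V | c.IsCycle ∧ v ∈ c.support} : Finset _),
          (∑ σ ∈ {σ ∈ ({σ : Equiv.Perm V | ¬ σ v = v} : Finset _) | σ.cycleOf v = c},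
            ∏ i, G.lapMatrix ℝ (σ i) i) =
          if ∀ a ∈ c.support, G.Adj a (c a) then
            (-1) ^ c.support.card * permDel G c.support else 0 := by
        intro c hc
        rw [Finset.mem_filter] at hc
        have h := sum_perm_agree_eq (G.lapMatrix ℝ) c c.support (by simp)
        rw [Finset.toFinset_coe, prod_support_lapMatrix, ite_mul, zero_mul] at h
        refine (Finset.sum_congr (Finset.ext fun σ => ?_) fun _ _ => rfl).trans h
        simp only [Finset.mem_filter, Finset.mem_univ, true_and]
        exact cycleOf_eq_iff_agree hc.2.1 hc.2.2
      rw [Finset.sum_congr rfl hsum, ← Finset.sum_filter, Finset.filter_filter]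
      simp only [adjCycles, and_assoc]
    · intro σ hσ
      rw [Finset.mem_filter] at hσ ⊢
      exact ⟨Finset.mem_univ _, Equiv.Perm.isCycle_cycleOf _ hσ.2,
        Equiv.Perm.mem_support_cycleOf_iff.2 ⟨.refl _ _, Equiv.Perm.mem_support.2 hσ.2⟩⟩

theorem sum_adjCycles_card_eq_two {V : Type*} [Fintype V] (G : SimpleGraph V) (v : V) :
    ∑ c ∈ adjCycles G v with c.support.card = 2, (-1) ^ c.support.card * permDel G c.support =
      ∑ u ∈ G.neighborFinset v, permDel G {v, u} := by
  symm
  refine Finset.sum_bij (fun u _ => Equiv.swap v u) ?_ ?_ ?_ ?_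
  · intro u hu
    rw [SimpleGraph.mem_neighborFinset] at hu
    simp only [adjCycles, Finset.mem_filter, Finset.mem_univ, true_and]
    refine ⟨⟨Equiv.Perm.isCycle_swap hu.ne, ?_⟩, Equiv.Perm.card_support_swap hu.ne⟩
    rw [Equiv.Perm.support_swap hu.ne]
    simpa using ⟨hu, hu.symm⟩
  · intro u _ u' _ h
    simpa using Equiv.ext_iff.1 h v
  · intro c hc
    simp only [adjCycles, Finset.mem_filter, Finset.mem_univ, true_and] at hc
    obtain ⟨⟨hc, hv, hG⟩, h2⟩ := hc
    refine ⟨c v, by simpa using hG v hv, ?_⟩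
    obtain ⟨x, y, hxy, rfl⟩ := Equiv.Perm.card_support_eq_two.1 h2
    rw [Equiv.Perm.support_swap hxy, Finset.mem_insert, Finset.mem_singleton] at hv
    rcases hv with rfl | rfl
    · simp
    · simp [Equiv.swap_comm]
  · intro u hu
    rw [SimpleGraph.mem_neighborFinset] at hu
    rw [Equiv.Perm.card_support_swap hu.ne, Equiv.Perm.support_swap hu.ne]
    simp

theorem sum_adjCycles_card_ne_two {V : Type*} [Fintype V] (G : SimpleGraph V) (v : V) :
    ∑ c ∈ adjCycles G v with ¬ c.support.card = 2, (-1) ^ c.support.card * permDel G c.support =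
      2 * ∑ᶠ C ∈ {C : G.Subgraph | IsCycleSubgraph G C ∧ v ∈ C.verts},
          (-1 : ℝ) ^ C.verts.ncard * permDel G C.verts := by
  have hmem : ∀ c : Equiv.Perm V, c ∈ ({c ∈ adjCycles G v | ¬ c.support.card = 2} : Finset _) ↔
      c.IsCycle ∧ v ∈ c.support ∧ (∀ a ∈ c.support, G.Adj a (c a)) ∧ 3 ≤ c.support.card := by
    intro c
    simp only [adjCycles, Finset.mem_filter, Finset.mem_univ, true_and, and_assoc]
    refine and_congr_right fun hc => and_congr_right fun _ => and_congr_right fun _ => ?_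
    have := hc.two_le_card_support
    omega
  rw [finsum_mem_eq_finite_toFinset_sum _ (Set.toFinite _), Finset.mul_sum,
    ← Finset.sum_fiberwise_of_maps_to (g := permSubgraph G)]
  · refine Finset.sum_congr rfl fun C hC => ?_
    rw [Set.Finite.mem_toFinset] at hC
    obtain ⟨hC, hv⟩ := hC
    obtain ⟨c, hc, h3, hG, rfl⟩ := exists_eq_permSubgraph hC
    have hne : c ≠ c⁻¹ := fun h =>
      apply_ne_symm_apply_of_three_le hc h3 hv (Equiv.ext_iff.1 h v)
    have hfib : ({d ∈ ({c ∈ adjCycles G v | ¬ c.support.card = 2} : Finset _) |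
        permSubgraph G d = permSubgraph G c} : Finset _) = {c, c⁻¹} := by
      ext d
      rw [Finset.mem_filter, hmem, Finset.mem_insert, Finset.mem_singleton]
      constructor
      · rintro ⟨⟨-, -, hdG, -⟩, h⟩
        exact (permSubgraph_eq_iff hc hG h3 hdG).1 h
      · rintro (rfl | rfl)
        · exact ⟨⟨hc, hv, hG, h3⟩, rfl⟩
        · exact ⟨⟨hc.inv, by rwa [Equiv.Perm.support_inv], adj_inv_apply hG, by rwa [Equiv.Perm.support_inv]⟩,
            permSubgraph_inv G c⟩
    have hverts : (permSubgraph G c).verts = c.support := rfl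
    rw [hfib, Finset.sum_pair hne, Equiv.Perm.support_inv, ← two_mul, hverts,
      Set.ncard_coe_finset]
  · intro c hc
    obtain ⟨hc, hv, hG, h3⟩ := (hmem c).1 hc
    exact (Set.Finite.mem_toFinset _).2 ⟨isCycleSubgraph_permSubgraph hc h3 hG, hv⟩

/-- expansion of the permanent of the Laplacian at a vertex `v`. -/
theorem permL_vertex_expansion {V : Type*} [Fintype V] (G : SimpleGraph V) (v : V) :
    permL G = (G.degree v : ℝ) * permDel G {v}
      + (∑ᶠ u ∈ G.neighborSet v, permDel G {v, u})
      + 2 * ∑ᶠ C ∈ {C : G.Subgraph | IsCycleSubgraph G C ∧ v ∈ C.verts},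
          (-1 : ℝ) ^ C.verts.ncard * permDel G C.verts := by
  rw [permL_eq_add_sum_adjCycles,
    ← Finset.sum_filter_add_sum_filter_not _ (fun c : Equiv.Perm V => c.support.card = 2),
    sum_adjCycles_card_eq_two, sum_adjCycles_card_ne_two, add_assoc,
    finsum_mem_eq_toFinset_sum (fun u => permDel G {v, u})]
  rfl
end

section
/- Let G be a simple graph, let v be a pendant vertex of G (a vertex of degree 1), and let u be the unique vertex adjacent to v. Then per L(G) = per L(G−v) + 2·per L_u(G−v), where G−v is the graph obtained from G by deleting v. -/
open scoped Classical

/-- The permanent is invariant under simultaneous reindexing of rows and columns. -/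
theorem Matrix.permanent_submatrix_equiv_self {m n R : Type*} [Fintype m] [DecidableEq m]
    [Fintype n] [DecidableEq n] [CommSemiring R] (e : m ≃ n) (M : Matrix n n R) :
    (M.submatrix e e).permanent = M.permanent := by
  unfold Matrix.permanent
  refine Fintype.sum_equiv e.permCongr _ _ fun σ => ?_
  refine Fintype.prod_equiv e _ _ fun i => ?_
  simp [Equiv.permCongr_apply]

/-- Expansion of the permanent of a matrix indexed by `Option n` along the column `none`. -/
theorem Matrix.permanent_option {n R : Type*} [Fintype n] [DecidableEq n] [CommSemiring R]
    (M : Matrix (Option n) (Option n) R) :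
    M.permanent = ∑ k, M k none *
      (M.submatrix (fun a : n => Equiv.swap none k (some a)) some).permanent := by
  unfold Matrix.permanent
  rw [← Equiv.sum_comp Equiv.Perm.decomposeOption.symm, Fintype.sum_prod_type]
  refine Finset.sum_congr rfl fun k _ => ?_
  rw [Finset.mul_sum]
  refine Finset.sum_congr rfl fun σ _ => ?_
  rw [Fintype.prod_option]
  simp

/-- Laplace expansion of the permanent along the column `v`. -/
theorem Matrix.permanent_eq_sum_mul_permanent_submatrix {n R : Type*} [Fintype n] [DecidableEq n]
    [CommSemiring R] (M : Matrix n n R) (v : n) :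
    M.permanent = ∑ k, M k v * (M.submatrix (fun a : ↥({v}ᶜ : Set n) => Equiv.swap v k a)
      (fun a : ↥({v}ᶜ : Set n) => (a : n))).permanent := by
  let e : Option ↥({v}ᶜ : Set n) ≃ n := Equiv.optionSubtypeNe v
  have hnone : e none = v := Equiv.optionSubtypeNe_none v
  have hsome (a : ↥({v}ᶜ : Set n)) : e (some a) = a := Equiv.optionSubtypeNe_some v a
  rw [← Matrix.permanent_submatrix_equiv_self e, Matrix.permanent_option, ← Equiv.sum_comp e]
  refine Finset.sum_congr rfl fun k _ => ?_
  rw [Matrix.submatrix_apply, hnone]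
  congr 2
  ext a b
  simp only [Matrix.submatrix_apply, hsome]
  rw [e.injective.map_swap, hnone, hsome]

/-- If row `v` of a matrix vanishes off the diagonal, its permanent is the diagonal entry times
the permanent of the complementary principal submatrix. -/
theorem Matrix.permanent_eq_mul_of_row_eq_zero {n R : Type*} [Fintype n] [DecidableEq n]
    [CommSemiring R] (M : Matrix n n R) (v : n) (h : ∀ k, k ≠ v → M v k = 0) :
    M.permanent = M v v * (M.submatrix (fun a : ↥({v}ᶜ : Set n) => (a : n))
      (fun a : ↥({v}ᶜ : Set n) => (a : n))).permanent := by
  rw [← Matrix.permanent_transpose, Matrix.permanent_eq_sum_mul_permanent_submatrix _ v,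
    Fintype.sum_eq_single v fun k hk => by rw [Matrix.transpose_apply, h k hk, zero_mul],
    ← Matrix.permanent_transpose]
  simp [Matrix.transpose_submatrix]

/-- Adding `c` to a diagonal entry of a matrix adds `c` times the permanent of the complementary
principal submatrix to its permanent. -/
theorem Matrix.permanent_add_single {n R : Type*} [Fintype n] [DecidableEq n]
    [CommSemiring R] (M : Matrix n n R) (v : n) (c : R) :
    (M + Matrix.single v v c).permanent = M.permanent +
      c * (M.submatrix (fun a : ↥({v}ᶜ : Set n) => (a : n))
        (fun a : ↥({v}ᶜ : Set n) => (a : n))).permanent := by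
  have hminor (k : n) : (M + Matrix.single v v c).submatrix
      (fun a : ↥({v}ᶜ : Set n) => Equiv.swap v k a) (fun a : ↥({v}ᶜ : Set n) => (a : n)) =
      M.submatrix (fun a : ↥({v}ᶜ : Set n) => Equiv.swap v k a)
        (fun a : ↥({v}ᶜ : Set n) => (a : n)) := by
    ext a b
    have hb : v ≠ b := Ne.symm b.2
    simp [hb]
  rw [Matrix.permanent_eq_sum_mul_permanent_submatrix _ v,
    Matrix.permanent_eq_sum_mul_permanent_submatrix M v]
  simp only [hminor, Matrix.add_apply, add_mul, Finset.sum_add_distrib]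
  congr 1
  rw [Fintype.sum_eq_single v fun k hk => by simp [hk.symm]]
  simp

/-- Deleting a pendant vertex `v` with neighbour `u` lowers the Laplacian by one in the diagonal
entry of `u` and leaves the other entries among the remaining vertices unchanged. -/
theorem SimpleGraph.lapMatrix_submatrix_compl_pendant {V : Type*} [Fintype V] (G : SimpleGraph V)
    (v : V) (u : ↥({v}ᶜ : Set V)) (hv : ∀ w, G.Adj v w ↔ w = u) :
    (G.lapMatrix ℝ).submatrix (fun a : ↥({v}ᶜ : Set V) => (a : V))
      (fun a : ↥({v}ᶜ : Set V) => (a : V)) =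
    (G.induce ({v}ᶜ : Set V)).lapMatrix ℝ + Matrix.single u u 1 := by
  have hdeg (a : ↥({v}ᶜ : Set V)) : (G.degree a : ℝ) =
      ((G.induce ({v}ᶜ : Set V)).degree a : ℝ) + if a = u then 1 else 0 := by
    have hsum := Fintype.sum_equiv (Equiv.optionSubtypeNe v)
      (fun x => if G.Adj a (Equiv.optionSubtypeNe v x) then (1 : ℝ) else 0)
      (fun x => if G.Adj a x then (1 : ℝ) else 0) fun _ => rfl
    rw [Fintype.sum_option] at hsum
    rw [SimpleGraph.degree_eq_sum_if_adj, SimpleGraph.degree_eq_sum_if_adj, ← hsum, add_comm]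
    congr 1
    simp [G.adj_comm a v, hv, Subtype.ext_iff]
  ext a b
  by_cases hab : a = b
  · subst hab
    simp [SimpleGraph.lapMatrix, SimpleGraph.degMatrix, hdeg, Matrix.single_apply, eq_comm]
  · have hab' : (a : V) ≠ b := fun h => hab (Subtype.ext h)
    have hu : ¬ (u = a ∧ u = b) := fun h => hab (h.1.symm.trans h.2)
    simp [SimpleGraph.lapMatrix, SimpleGraph.degMatrix, hab, hab', hu]

theorem permL_eq_permanent {V : Type*} [Fintype V] [DecidableEq V] (G : SimpleGraph V)
    [DecidableRel G.Adj] : permL G = (G.lapMatrix ℝ).permanent := by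
  unfold permL
  congr!

theorem permDel_singleton {V : Type*} [Fintype V] [DecidableEq V] (G : SimpleGraph V)
    [DecidableRel G.Adj] (u : V) :
    permDel G {u} = ((G.lapMatrix ℝ).submatrix (fun a : ↥({u}ᶜ : Set V) => (a : V))
      (fun a : ↥({u}ᶜ : Set V) => (a : V))).permanent := by
  unfold permDel
  congr!

/-- if `v` is a pendant vertex with neighbor `u`, then
`per L(G) = per L(G−v) + 2·per L_u(G−v)`. -/
theorem permL_pendant {V : Type*} [Fintype V] (G : SimpleGraph V) (v u : V)
    (hdeg : G.degree v = 1) (hadj : G.Adj u v) :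
    permL G = permL (G.induce ({v}ᶜ : Set V))
      + 2 * permDel (G.induce ({v}ᶜ : Set V))
          {(⟨u, Set.mem_compl_singleton_iff.mpr hadj.ne⟩ : ↥({v}ᶜ : Set V))} := by
  have hv (w : V) : G.Adj v w ↔ w = u := by
    obtain ⟨x, -, hx⟩ := SimpleGraph.degree_eq_one_iff_existsUnique_adj.mp hdeg
    exact ⟨fun h => (hx w h).trans (hx u hadj.symm).symm, fun h => h ▸ hadj.symm⟩
  have hvv : G.lapMatrix ℝ v v = 1 := by
    simp [SimpleGraph.lapMatrix, SimpleGraph.degMatrix, hdeg]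
  have hvw (w : V) (hw : w ≠ v) : G.lapMatrix ℝ v w = if w = u then -1 else 0 := by
    simp only [SimpleGraph.lapMatrix, SimpleGraph.degMatrix, Matrix.sub_apply,
      Matrix.diagonal_apply_ne' _ hw, SimpleGraph.adjMatrix_apply, hv]
    split_ifs <;> simp
  have hwv (w : V) (hw : w ≠ v) : G.lapMatrix ℝ w v = if w = u then -1 else 0 := by
    rw [← hvw w hw, (G.isSymm_lapMatrix (R := ℝ)).apply]
  set u' : ↥({v}ᶜ : Set V) := ⟨u, Set.mem_compl_singleton_iff.mpr hadj.ne⟩ with hu'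
  have hsub := G.lapMatrix_submatrix_compl_pendant v u' hv
  have hswap : ((G.lapMatrix ℝ).submatrix (fun a : ↥({v}ᶜ : Set V) => Equiv.swap v u a)
      (fun a : ↥({v}ᶜ : Set V) => (a : V))).permanent =
      -permDel (G.induce ({v}ᶜ : Set V)) {u'} := by
    rw [Matrix.permanent_eq_mul_of_row_eq_zero _ u' fun k hk => ?_]
    · have huu : G.lapMatrix ℝ (Equiv.swap v u u') u' = -1 := by
        simp [hu', hvw u hadj.ne]
      rw [Matrix.submatrix_apply, huu, neg_one_mul, permDel_singleton]
      congr 2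
      ext a b
      have ha : (a : V) ≠ u := fun h => a.2 (Subtype.ext h)
      have hau : u' ≠ a := Ne.symm a.2
      have h := congrFun₂ hsub a b
      simp only [Matrix.submatrix_apply, Matrix.add_apply, Matrix.single_apply, hau, false_and,
        if_false, add_zero] at h
      simp only [Matrix.submatrix_apply, Equiv.swap_apply_of_ne_of_ne a.1.2 ha, h]
    · have hk' : (k : V) ≠ u := fun h => hk (Subtype.ext h)
      simp [hu', hvw k k.2, hk']
  rw [permL_eq_permanent, Matrix.permanent_eq_sum_mul_permanent_submatrix _ v,
    Fintype.sum_eq_add v u hadj.ne.symm fun w hw => by simp [hwv w hw.1, hw.2], hswap, hvv,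
    hwv u hadj.ne]
  simp only [Equiv.swap_self, Equiv.refl_apply, hsub, Matrix.permanent_add_single, if_true,
    permL_eq_permanent, permDel_singleton]
  ring
end

section
/- Let G be a simple graph, let v be a pendant vertex of G with unique neighbor u. Then per L_v(G) = per L(G−v) + per L_{uv}(G), where G−v is the graph obtained from G by deleting v. -/
open scoped Classical

namespace Matrix

open Equiv

variable {m n R : Type*} [DecidableEq m] [Fintype m] [DecidableEq n] [Fintype n] [CommSemiring R]

theorem permanent_submatrix_equiv_self_s3 (e : n ≃ m) (A : Matrix m m R) :
    (A.submatrix e e).permanent = A.permanent := by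
  refine Fintype.sum_equiv (Equiv.permCongr e) _ _ fun σ => ?_
  refine Fintype.prod_equiv e _ _ fun i => ?_
  rw [Equiv.permCongr_apply, Equiv.symm_apply_apply, submatrix_apply]

/-- The sum over permutations fixing `a` in the expansion of a permanent, without the diagonal
factor at `a`, is the permanent of the complementary principal minor. -/
theorem sum_perm_fixing_prod_erase (A : Matrix n n R) (a : n) :
    ∑ σ : Perm n with σ a = a, ∏ i ∈ Finset.univ.erase a, A (σ i) i =
      (A.submatrix (Subtype.val : {i // i ≠ a} → n) Subtype.val).permanent := by
  symm
  refine Finset.sum_bij (fun σ _ => Perm.ofSubtype σ) (fun σ _ => ?_)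
    (fun _ _ _ _ h => Perm.ofSubtype_injective h) (fun σ hσ => ?_) (fun σ _ => ?_)
  · simpa using Perm.ofSubtype_apply_of_not_mem σ (by simp)
  · have hσ : σ a = a := by simpa using hσ
    have h : ∀ i, σ i ≠ a ↔ i ≠ a := fun i =>
      not_congr (by simpa only [hσ] using σ.apply_eq_iff_eq (x := i) (y := a))
    refine ⟨σ.subtypePerm h, Finset.mem_univ _, Perm.ofSubtype_subtypePerm h fun i hi => ?_⟩
    rintro rfl
    exact hi hσ
  · rw [Finset.prod_subtype (p := (· ≠ a)) (F := inferInstance) _ (by simp)]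
    simp

/-- Adding `c` to a diagonal entry of a matrix adds `c` times the permanent of the complementary
principal minor to its permanent. -/
theorem permanent_add_single_self (A : Matrix n n R) (a : n) (c : R) :
    (A + single a a c).permanent = A.permanent +
      c * (A.submatrix (Subtype.val : {i // i ≠ a} → n) Subtype.val).permanent := by
  rw [← sum_perm_fixing_prod_erase, Finset.mul_sum, Finset.sum_filter, permanent, permanent,
    ← Finset.sum_add_distrib]
  refine Finset.sum_congr rfl fun σ _ => ?_
  rw [← Finset.mul_prod_erase _ _ (Finset.mem_univ a),
    ← Finset.mul_prod_erase _ (fun i => A (σ i) i) (Finset.mem_univ a)]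
  have h : ∏ i ∈ Finset.univ.erase a, (A + single a a c) (σ i) i =
      ∏ i ∈ Finset.univ.erase a, A (σ i) i := by
    refine Finset.prod_congr rfl fun i hi => ?_
    simp [(Finset.ne_of_mem_erase hi).symm]
  rw [h]
  split_ifs with hσ
  · simp [hσ, add_mul]
  · simp [Ne.symm hσ]

end Matrix

theorem SimpleGraph.degree_induce_compl_singleton_add {V : Type*} [Fintype V] (G : SimpleGraph V)
    (v : V) (i : ({v}ᶜ : Set V)) :
    (G.induce ({v}ᶜ : Set V)).degree i + (if G.Adj i v then 1 else 0) = G.degree i := by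
  have h : ((G.induce ({v}ᶜ : Set V)).neighborFinset i).map (.subtype _) =
      (G.neighborFinset i).erase v := by
    ext; simp [and_comm]
  rw [← card_neighborFinset_eq_degree, ← Finset.card_map, h]
  split_ifs with hi
  · simpa using Finset.card_erase_add_one ((G.mem_neighborFinset i v).mpr hi)
  · rw [Finset.erase_eq_of_notMem (by simpa using hi)]
    simp

/-- if `v` is a pendant vertex with neighbor `u`, then
`per L_v(G) = per L(G−v) + per L_{uv}(G)`. -/
theorem permDel_pendant {V : Type*} [Fintype V] (G : SimpleGraph V) (v u : V)
    (hdeg : G.degree v = 1) (hadj : G.Adj u v) :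
    permDel G {v} = permL (G.induce ({v}ᶜ : Set V)) + permDel G {u, v} := by
  have hu : ∀ i, G.Adj i v → i = u := fun i hi =>
    (SimpleGraph.degree_eq_one_iff_existsUnique_adj.mp hdeg).unique hi.symm hadj.symm
  let a : ({v}ᶜ : Set V) := ⟨u, hadj.ne⟩
  have hmat : (G.lapMatrix ℝ).submatrix (Subtype.val : ({v}ᶜ : Set V) → V) Subtype.val =
      (G.induce ({v}ᶜ : Set V)).lapMatrix ℝ + Matrix.single a a 1 := by
    ext i j
    have hdeg_i := G.degree_induce_compl_singleton_add v i
    have hai : a = i ↔ G.Adj i v :=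
      ⟨fun h => h ▸ hadj, fun h => Subtype.ext (hu i h).symm⟩
    by_cases hij : i = j
    · subst hij
      simp [SimpleGraph.lapMatrix, SimpleGraph.degMatrix, Matrix.single_apply, hai, ← hdeg_i]
    · have : ¬ (a = i ∧ a = j) := fun h => hij (h.1.symm.trans h.2)
      simp [SimpleGraph.lapMatrix, SimpleGraph.degMatrix, hij, this,
        Subtype.val_injective.ne hij]
  let e : {i : ({v}ᶜ : Set V) // i ≠ a} ≃ ({u, v}ᶜ : Set V) :=
    { toFun := fun i => ⟨i, by
        rintro (h | h)
        exacts [i.2 (Subtype.ext h), i.1.2 h]⟩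
      invFun := fun i => ⟨⟨i, fun h => i.2 (Or.inr h)⟩,
        fun h => i.2 (Or.inl (congrArg Subtype.val h))⟩
      left_inv := fun _ => rfl
      right_inv := fun _ => rfl }
  have hminor : ((G.induce ({v}ᶜ : Set V)).lapMatrix ℝ).submatrix
      (Subtype.val : {i // i ≠ a} → _) Subtype.val =
      ((G.lapMatrix ℝ).submatrix (Subtype.val : ({u, v}ᶜ : Set V) → V) Subtype.val).submatrix
        e e := by
    ext i j
    have h := congrFun (congrFun hmat i) j
    rw [Matrix.add_apply, Matrix.single_apply_of_row_ne i.2.symm, add_zero] at h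
    exact h.symm
  rw [permDel, permDel, permL, hmat, Matrix.permanent_add_single_self, one_mul, hminor,
    Matrix.permanent_submatrix_equiv_self_s3]
  congr!
end
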